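/- Let k be an integer with k ≥ 4, and define τ(k) = 1/(4k(k−2)). Then for every ε > 0 there exists N₀ = N₀(k,ε) such that for all α ∈ ℝ^k and all natural numbers N ≥ N₀, one has min_{1≤n≤N} ‖α₁n + α₂n² + ⋯ + α_k n^k‖ < N^{ε − τ(k)}. -/

import Mathlib

namespace VMV

open Finset

section Grid

lemma AddChar_sum {G : Type*} [AddCommGroup G] {ι : Type*} (ψ : AddChar G ℂ) (s : Finset ι)
    (f : ι → G) : ψ (∑ i ∈ s, f i) = ∏ i ∈ s, ψ (f i) := by
  classical
  induction s using Finset.induction_on with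
  | empty => simp
  | insert a s ha ih => rw [Finset.sum_insert ha, Finset.prod_insert ha, AddChar.map_add_eq_mul, ih]

variable {k Q : ℕ} [NeZero Q]

noncomputable def ch (α : Fin k → ZMod Q) (v : Fin k → ℤ) : ℂ :=
  ZMod.stdAddChar (∑ j, α j * ((v j : ℤ) : ZMod Q))

lemma ch_add (α : Fin k → ZMod Q) (v w : Fin k → ℤ) : ch α (v + w) = ch α v * ch α w := by
  unfold ch
  rw [← AddChar.map_add_eq_mul, ← Finset.sum_add_distrib]
  congr 1
  apply Finset.sum_congr rfl
  intro j _
  simp [mul_add]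

lemma ch_zero (α : Fin k → ZMod Q) : ch α (0 : Fin k → ℤ) = 1 := by
  simp [ch]

lemma ch_norm (α : Fin k → ZMod Q) (v : Fin k → ℤ) : ‖ch α v‖ = 1 :=
  AddChar.norm_apply _ _

lemma ch_conj (α : Fin k → ZMod Q) (v : Fin k → ℤ) :
    (starRingEnd ℂ) (ch α v) = ch α (-v) := by
  unfold ch
  rw [← AddChar.map_neg_eq_conj, ← Finset.sum_neg_distrib]
  congr 1
  apply Finset.sum_congr rfl
  intro j _
  simp

lemma ch_sum {ι : Type*} (s : Finset ι) (α : Fin k → ZMod Q) (v : ι → Fin k → ℤ) :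
    ch α (∑ i ∈ s, v i) = ∏ i ∈ s, ch α (v i) := by
  classical
  induction s using Finset.induction_on with
  | empty => simp [ch_zero]
  | insert a s ha ih => rw [Finset.sum_insert ha, Finset.prod_insert ha, ch_add, ih]

lemma sum_ch (v : Fin k → ℤ) :
    ∑ α : Fin k → ZMod Q, ch α v = if ∀ j, ((v j : ℤ) : ZMod Q) = 0 then (Q : ℂ) ^ k else 0 := by
  have h1 : ∀ α : Fin k → ZMod Q, ch α v =
      ∏ j, ZMod.stdAddChar (α j * ((v j : ℤ) : ZMod Q)) := by
    intro α
    unfold ch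
    exact AddChar_sum _ _ _
  simp_rw [h1]
  have h2 := Finset.prod_univ_sum (fun _ : Fin k => (Finset.univ : Finset (ZMod Q)))
    (fun j a => (ZMod.stdAddChar (a * ((v j : ℤ) : ZMod Q)) : ℂ))
  rw [Fintype.piFinset_univ] at h2
  rw [← h2]
  have h3 : ∀ j, ∑ a : ZMod Q, (ZMod.stdAddChar (a * ((v j : ℤ) : ZMod Q)) : ℂ) =
      if ((v j : ℤ) : ZMod Q) = 0 then (Q : ℂ) else 0 := by
    intro j
    rw [AddChar.sum_mulShift _ (ZMod.isPrimitive_stdAddChar Q)]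
    split_ifs <;> simp [ZMod.card]
  simp_rw [h3]
  split_ifs with h
  · simp [h]
  · push Not at h
    obtain ⟨j, hj⟩ := h
    exact Finset.prod_eq_zero (Finset.mem_univ j) (by simp [hj])

noncomputable def E (g : (Fin k → ZMod Q) → ℝ) : ℝ := (∑ α, g α) / (Q : ℝ) ^ k

lemma Qpos : (0 : ℝ) < (Q : ℝ) ^ k := by
  have : 0 < Q := Nat.pos_of_ne_zero (NeZero.ne Q)
  positivity

lemma E_mono {g h : (Fin k → ZMod Q) → ℝ} (H : ∀ α, g α ≤ h α) : E g ≤ E h := by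
  unfold E
  have := Qpos (k := k) (Q := Q)
  gcongr with α
  exact H α

lemma E_nonneg {g : (Fin k → ZMod Q) → ℝ} (H : ∀ α, 0 ≤ g α) : 0 ≤ E g := by
  unfold E
  exact div_nonneg (Finset.sum_nonneg fun α _ => H α) Qpos.le

lemma E_add (g h : (Fin k → ZMod Q) → ℝ) : E (fun α => g α + h α) = E g + E h := by
  unfold E
  rw [Finset.sum_add_distrib, add_div]

lemma E_mul (c : ℝ) (g : (Fin k → ZMod Q) → ℝ) : E (fun α => c * g α) = c * E g := by
  unfold E
  rw [← Finset.mul_sum, mul_div_assoc]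

lemma E_sum {ι : Type*} (s : Finset ι) (g : ι → (Fin k → ZMod Q) → ℝ) :
    E (fun α => ∑ i ∈ s, g i α) = ∑ i ∈ s, E (g i) := by
  unfold E
  rw [Finset.sum_comm, Finset.sum_div]

lemma E_holder {F G : (Fin k → ZMod Q) → ℝ} (hF : ∀ α, 0 ≤ F α) (hG : ∀ α, 0 ≤ G α)
    {θ : ℝ} (h0 : 0 < θ) (h1 : θ < 1) :
    E (fun α => F α ^ θ * G α ^ (1 - θ)) ≤ E F ^ θ * E G ^ (1 - θ) := by
  have h1' : 0 < 1 - θ := by linarith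
  have hpq : (θ⁻¹).HolderConjugate ((1 - θ)⁻¹) := by
    refine ⟨by simp, by positivity, by positivity⟩
  have := Real.inner_le_Lp_mul_Lq_of_nonneg (Finset.univ) (f := fun α => F α ^ θ)
    (g := fun α => G α ^ (1 - θ)) hpq (fun α _ => Real.rpow_nonneg (hF α) _)
    (fun α _ => Real.rpow_nonneg (hG α) _)
  have e1 : ∀ α, (F α ^ θ) ^ θ⁻¹ = F α := fun α => by
    rw [← Real.rpow_mul (hF α), mul_inv_cancel₀ h0.ne', Real.rpow_one]
  have e2 : ∀ α, (G α ^ (1 - θ)) ^ (1 - θ)⁻¹ = G α := fun α => by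
    rw [← Real.rpow_mul (hG α), mul_inv_cancel₀ h1'.ne', Real.rpow_one]
  simp only [e1, e2, one_div, inv_inv] at this
  unfold E
  have hq := Qpos (k := k) (Q := Q)
  rw [Real.div_rpow (Finset.sum_nonneg fun α _ => hF α) hq.le,
    Real.div_rpow (Finset.sum_nonneg fun α _ => hG α) hq.le, div_mul_div_comm,
    ← Real.rpow_add hq]
  simp only [add_sub_cancel, Real.rpow_one]
  gcongr

/-- mean square as a count -/
lemma E_sq {ι : Type*} [DecidableEq ι] (Z : Finset ι) (u : ι → Fin k → ℤ) :
    E (fun α : Fin k → ZMod Q => ‖∑ z ∈ Z, ch α (u z)‖ ^ 2) =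
      (#{q ∈ Z ×ˢ Z | ∀ j, ((u q.1 j : ℤ) : ZMod Q) = ((u q.2 j : ℤ) : ZMod Q)} : ℝ) := by
  have h : ∀ α : Fin k → ZMod Q, ((‖∑ z ∈ Z, ch α (u z)‖ ^ 2 : ℝ) : ℂ) =
      ∑ q ∈ Z ×ˢ Z, ch α (u q.1 - u q.2) := by
    intro α
    push_cast
    rw [← Complex.mul_conj', map_sum, Finset.sum_mul_sum, ← Finset.sum_product']
    apply Finset.sum_congr rfl
    intro q _
    rw [ch_conj, ← ch_add, sub_eq_add_neg]
  have h2 : ((∑ α : Fin k → ZMod Q, ‖∑ z ∈ Z, ch α (u z)‖ ^ 2 : ℝ) : ℂ) =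
      (#{q ∈ Z ×ˢ Z | ∀ j, ((u q.1 j : ℤ) : ZMod Q) = ((u q.2 j : ℤ) : ZMod Q)} : ℂ)
        * (Q : ℂ) ^ k := by
    rw [Complex.ofReal_sum]
    simp_rw [h]
    rw [Finset.sum_comm]
    simp_rw [sum_ch]
    rw [← Finset.sum_filter, Finset.sum_const, nsmul_eq_mul]
    congr 3
    apply Finset.filter_congr
    intro q _
    simp [sub_eq_zero]
  have h3 : (∑ α : Fin k → ZMod Q, ‖∑ z ∈ Z, ch α (u z)‖ ^ 2) =
      (#{q ∈ Z ×ˢ Z | ∀ j, ((u q.1 j : ℤ) : ZMod Q) = ((u q.2 j : ℤ) : ZMod Q)} : ℝ)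
        * (Q : ℝ) ^ k := by exact_mod_cast h2
  unfold E
  rw [h3, mul_div_assoc, div_self Qpos.ne', mul_one]

lemma E_sq_coef {ι : Type*} [DecidableEq ι] (Z : Finset ι) (u : ι → Fin k → ℤ) (a : ι → ℂ)
    (ha : ∀ z, ‖a z‖ ≤ 1) :
    E (fun α : Fin k → ZMod Q => ‖∑ z ∈ Z, a z * ch α (u z)‖ ^ 2) ≤
      (#{q ∈ Z ×ˢ Z | ∀ j, ((u q.1 j : ℤ) : ZMod Q) = ((u q.2 j : ℤ) : ZMod Q)} : ℝ) := by
  have h : ∀ α : Fin k → ZMod Q, ((‖∑ z ∈ Z, a z * ch α (u z)‖ ^ 2 : ℝ) : ℂ) =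
      ∑ q ∈ Z ×ˢ Z, a q.1 * (starRingEnd ℂ) (a q.2) * ch α (u q.1 - u q.2) := by
    intro α
    push_cast
    rw [← Complex.mul_conj', map_sum, Finset.sum_mul_sum, ← Finset.sum_product']
    apply Finset.sum_congr rfl
    intro q _
    rw [sub_eq_add_neg, ch_add, ← ch_conj, map_mul]
    ring
  have h2 : ((∑ α : Fin k → ZMod Q, ‖∑ z ∈ Z, a z * ch α (u z)‖ ^ 2 : ℝ) : ℂ) =
      ∑ q ∈ Z ×ˢ Z with ∀ j, ((u q.1 j : ℤ) : ZMod Q) = ((u q.2 j : ℤ) : ZMod Q),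
        a q.1 * (starRingEnd ℂ) (a q.2) * (Q : ℂ) ^ k := by
    rw [Complex.ofReal_sum]
    simp_rw [h]
    rw [Finset.sum_comm]
    simp_rw [← Finset.mul_sum, sum_ch, Finset.sum_filter]
    apply Finset.sum_congr rfl
    intro q _
    simp [sub_eq_zero]
  have hnn : 0 ≤ (∑ α : Fin k → ZMod Q, ‖∑ z ∈ Z, a z * ch α (u z)‖ ^ 2 : ℝ) :=
    Finset.sum_nonneg fun _ _ => by positivity
  have h3 : (∑ α : Fin k → ZMod Q, ‖∑ z ∈ Z, a z * ch α (u z)‖ ^ 2) ≤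
      (#{q ∈ Z ×ˢ Z | ∀ j, ((u q.1 j : ℤ) : ZMod Q) = ((u q.2 j : ℤ) : ZMod Q)} : ℝ)
        * (Q : ℝ) ^ k := by
    have : (∑ α : Fin k → ZMod Q, ‖∑ z ∈ Z, a z * ch α (u z)‖ ^ 2 : ℝ) =
      ‖((∑ α : Fin k → ZMod Q, ‖∑ z ∈ Z, a z * ch α (u z)‖ ^ 2 : ℝ) : ℂ)‖ := by
      rw [Complex.norm_real, Real.norm_of_nonneg hnn]
    rw [this, h2]
    refine (norm_sum_le _ _).trans ?_
    rw [← nsmul_eq_mul]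
    apply Finset.sum_le_card_nsmul
    intro q _
    simp only [norm_mul, norm_pow, RCLike.norm_conj, Complex.norm_natCast]
    calc ‖a q.1‖ * ‖a q.2‖ * (Q : ℝ) ^ k ≤ 1 * 1 * (Q : ℝ) ^ k := by
          gcongr
          · exact ha _
          · exact ha _
      _ = _ := by ring
  unfold E
  rw [div_le_iff₀ Qpos]
  exact h3

/-- orthogonal decomposition -/
lemma E_sq_decomp {ι M : Type*} [DecidableEq ι] [DecidableEq M] (Z : Finset ι)
    (u : ι → Fin k → ℤ) (κ : ι → M) (T : Finset M) (hT : ∀ z ∈ Z, κ z ∈ T)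
    (hκ : ∀ z ∈ Z, ∀ w ∈ Z,
      (∀ j, ((u z j : ℤ) : ZMod Q) = ((u w j : ℤ) : ZMod Q)) → κ z = κ w) :
    E (fun α : Fin k → ZMod Q => ‖∑ z ∈ Z, ch α (u z)‖ ^ 2) =
      ∑ m ∈ T, E (fun α : Fin k → ZMod Q => ‖∑ z ∈ Z with κ z = m, ch α (u z)‖ ^ 2) := by
  simp_rw [E_sq]
  rw [← Nat.cast_sum, Nat.cast_inj]
  rw [Finset.card_eq_sum_card_fiberwise (f := fun q : ι × ι => κ q.1) (t := T)]
  · apply Finset.sum_congr rfl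
    intro m _
    congr 1
    ext q
    simp only [Finset.mem_filter, Finset.mem_product]
    constructor
    · rintro ⟨⟨⟨h1, h2⟩, h3⟩, h4⟩
      refine ⟨⟨⟨h1, h4⟩, h2, ?_⟩, h3⟩
      rw [← hκ _ h1 _ h2 h3, h4]
    · rintro ⟨⟨⟨h1, h4⟩, h2, h5⟩, h3⟩
      exact ⟨⟨⟨h1, h2⟩, h3⟩, h4⟩
  · intro q hq
    simp only [Finset.coe_filter, Finset.mem_product, Set.mem_ofPred_eq] at hq
    exact hT _ hq.1.1

end Grid

section Misc

lemma prod_le_sum_pow {r : ℕ} (hr : 1 ≤ r) (a : Fin r → ℝ) (ha : ∀ i, 0 ≤ a i) :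
    ∏ i, a i ≤ ∑ i, a i ^ r := by
  have : Nonempty (Fin r) := ⟨⟨0, hr⟩⟩
  obtain ⟨m, -, hm⟩ := Finset.exists_max_image Finset.univ a Finset.univ_nonempty
  calc ∏ i, a i ≤ ∏ _i : Fin r, a m := Finset.prod_le_prod (fun i _ => ha i) fun i _ => hm i (Finset.mem_univ i)
    _ = a m ^ r := by simp
    _ ≤ _ := Finset.single_le_sum (f := fun i => a i ^ r) (fun i _ => pow_nonneg (ha i) _) (Finset.mem_univ m)

/-- broad-narrow -/
lemma broad_narrow {ι : Type*} [DecidableEq ι] (Z : Finset ι) (v : ι → ℝ) (hv : ∀ i, 0 ≤ v i)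
    (r e : ℕ) (hr : 1 ≤ r) (he : 1 ≤ e) :
    (∑ z ∈ Z, v z) ^ (r * e) ≤ (2 * r : ℝ) ^ (r * e) * ∑ z ∈ Z, v z ^ (r * e) +
      (2 * (#Z : ℝ)) ^ (r * e) *
        ∑ u ∈ (Fintype.piFinset fun _ : Fin r => Z) with Function.Injective u,
          ∏ i, v (u i) ^ e := by
  set S := ∑ z ∈ Z, v z with hS
  have hS0 : 0 ≤ S := Finset.sum_nonneg fun i _ => hv i
  have hre : r * e ≠ 0 := by positivity
  have hn1 : 0 ≤ ∑ z ∈ Z, v z ^ (r * e) := Finset.sum_nonneg fun i _ => pow_nonneg (hv i) _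
  have hn2 : 0 ≤ ∑ u ∈ (Fintype.piFinset fun _ : Fin r => Z) with Function.Injective u,
          ∏ i, v (u i) ^ e :=
    Finset.sum_nonneg fun u _ => Finset.prod_nonneg fun i _ => pow_nonneg (hv _) _
  set T := Z.filter (fun z => S < 2 * #Z * v z) with hT
  by_cases hc : r ≤ #T
  · obtain ⟨T', hT', hc'⟩ := Finset.exists_subset_card_eq hc
    let u0 : Fin r → ι := fun i => ((T'.equivFin.symm (Fin.cast hc'.symm i)) : ι)
    have hu0 : ∀ i, u0 i ∈ T := fun i => hT' (Subtype.coe_prop _)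
    have hinj : Function.Injective u0 := by
      intro i j hij
      have := T'.equivFin.symm.injective (Subtype.ext hij)
      simpa using this
    have hmem : u0 ∈ (Fintype.piFinset fun _ : Fin r => Z).filter (fun u => Function.Injective u) := by
      rw [Finset.mem_filter, Fintype.mem_piFinset]
      exact ⟨fun i => (Finset.mem_filter.1 (hu0 i)).1, hinj⟩
    have hle := Finset.single_le_sum (f := fun u : Fin r → ι => ∏ i, v (u i) ^ e)
      (fun u _ => Finset.prod_nonneg fun i _ => pow_nonneg (hv _) _) hmem
    have key : S ^ (r * e) ≤ (2 * (#Z : ℝ)) ^ (r * e) * ∏ i, v (u0 i) ^ e := by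
      have : S ^ (r * e) = ∏ _i : Fin r, S ^ e := by
        simp [← pow_mul, mul_comm]
      rw [this]
      have h2 : (2 * (#Z : ℝ)) ^ (r * e) = ∏ _i : Fin r, (2 * (#Z : ℝ)) ^ e := by
        simp [← pow_mul, mul_comm]
      rw [h2, ← Finset.prod_mul_distrib]
      apply Finset.prod_le_prod
      · intro i _; positivity
      · intro i _
        rw [← mul_pow]
        exact pow_le_pow_left₀ hS0 (Finset.mem_filter.1 (hu0 i)).2.le _
    have h5 := mul_le_mul_of_nonneg_left hle (by positivity : (0 : ℝ) ≤ (2 * (#Z : ℝ)) ^ (r * e))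
    have : 0 ≤ (2 * r : ℝ) ^ (r * e) * ∑ z ∈ Z, v z ^ (r * e) := by positivity
    linarith
  · push Not at hc
    have h1 : S ≤ 2 * ∑ z ∈ T, v z := by
      have hsplit := Finset.sum_filter_add_sum_filter_not Z (fun z => S < 2 * #Z * v z) v
      rw [← hT] at hsplit
      have h3 : 2 * ∑ z ∈ Z with ¬ (S < 2 * #Z * v z), v z ≤ S := by
        by_cases hZ : #Z = 0
        · rw [Finset.card_eq_zero] at hZ
          subst hZ
          simp [hS]
        have hZ' : (0 : ℝ) < #Z := by positivity
        have : ∑ z ∈ Z with ¬ (S < 2 * #Z * v z), v z ≤ #Z * (S / (2 * #Z)) := by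
          calc _ ≤ ∑ z ∈ Z with ¬ (S < 2 * #Z * v z), (S / (2 * #Z)) := by
                apply Finset.sum_le_sum
                intro z hz
                have := (Finset.mem_filter.1 hz).2
                push Not at this
                rw [le_div_iff₀ (by positivity)]
                linarith
            _ ≤ ∑ z ∈ Z, (S / (2 * #Z)) := by
                apply Finset.sum_le_sum_of_subset_of_nonneg (Finset.filter_subset _ _)
                intros; positivity
            _ = _ := by simp
        have e : (#Z : ℝ) * (S / (2 * #Z)) = S / 2 := by field_simp
        rw [e] at this
        linarith
      linarith
    have h2 : (∑ z ∈ T, v z) ^ (r * e) ≤ (r : ℝ) ^ (r * e) * ∑ z ∈ Z, v z ^ (r * e) := by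
      obtain ⟨m, hm⟩ : ∃ m, r * e = m + 1 := ⟨r * e - 1, by omega⟩
      rw [hm]
      calc (∑ z ∈ T, v z) ^ (m + 1) ≤ (#T : ℝ) ^ m * ∑ z ∈ T, v z ^ (m + 1) :=
            pow_sum_le_card_mul_sum_pow (fun i _ => hv i) m
        _ ≤ (r : ℝ) ^ (m + 1) * ∑ z ∈ Z, v z ^ (m + 1) := by
            have h6 : (#T : ℝ) ≤ r := by exact_mod_cast hc.le
            have h7 : (1 : ℝ) ≤ r := by exact_mod_cast hr
            have h8 : ∑ z ∈ T, v z ^ (m + 1) ≤ ∑ z ∈ Z, v z ^ (m + 1) :=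
              Finset.sum_le_sum_of_subset_of_nonneg (Finset.filter_subset _ _)
                (fun i _ _ => pow_nonneg (hv i) _)
            have h9 : (#T : ℝ) ^ m ≤ (r : ℝ) ^ (m + 1) :=
              (pow_le_pow_left₀ (by positivity) h6 m).trans (pow_le_pow_right₀ h7 (by omega))
            exact mul_le_mul h9 h8 (Finset.sum_nonneg fun i _ => pow_nonneg (hv i) _) (by positivity)
    have h10 : S ^ (r * e) ≤ (2 * ∑ z ∈ T, v z) ^ (r * e) := pow_le_pow_left₀ hS0 h1 _
    rw [mul_pow] at h10
    have h11 : (2 * r : ℝ) ^ (r * e) * ∑ z ∈ Z, v z ^ (r * e) =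
      2 ^ (r * e) * ((r : ℝ) ^ (r * e) * ∑ z ∈ Z, v z ^ (r * e)) := by rw [mul_pow]; ring
    have h12 := mul_le_mul_of_nonneg_left h2 (by positivity : (0 : ℝ) ≤ 2 ^ (r * e))
    have h13 := mul_nonneg (by positivity : (0 : ℝ) ≤ (2 * (#Z : ℝ)) ^ (r * e)) hn2
    linarith

end Misc

end VMV


namespace VMV

open Finset

section Arith

lemma shift_sum {R ι : Type*} [CommRing R] [Fintype ι] (x : ι → R) (c : R) (j : ℕ) :
    ∑ i, (x i + c) ^ j = ∑ m ∈ range (j + 1), (∑ i, x i ^ m) * c ^ (j - m) * (j.choose m : R) := by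
  simp_rw [add_pow]
  rw [Finset.sum_comm]
  simp_rw [Finset.sum_mul]

lemma shift_eq {R ι : Type*} [CommRing R] [Fintype ι] {k : ℕ} {x y : ι → R}
    (h : ∀ j : Fin k, ∑ i, x i ^ ((j : ℕ) + 1) = ∑ i, y i ^ ((j : ℕ) + 1)) (c : R) (j : ℕ)
    (hj : j ≤ k) : ∑ i, (x i + c) ^ j = ∑ i, (y i + c) ^ j := by
  rw [shift_sum, shift_sum]
  apply Finset.sum_congr rfl
  intro m hm
  rw [Finset.mem_range] at hm
  congr 2
  rcases m with _ | m
  · simp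
  · exact h ⟨m, by omega⟩

lemma cast_pow_sum_iff {ι : Type*} [Fintype ι] (M : ℕ) (x y : ι → ℤ) (j : ℕ) :
    (∑ i, x i ^ j ≡ ∑ i, y i ^ j [ZMOD M]) ↔
      ∑ i, ((x i : ZMod M)) ^ j = ∑ i, ((y i : ZMod M)) ^ j := by
  rw [← ZMod.intCast_eq_intCast_iff]
  push_cast
  rfl

/-- Hensel-type uniqueness -/
lemma hensel {k p : ℕ} (hp : p.Prime) (hkp : k < p) (M : ℕ) (z w : Fin k → ℤ)
    (h1 : ∀ i, z i ≡ w i [ZMOD p]) (h2 : ∀ i j, i ≠ j → ¬ z i ≡ z j [ZMOD p])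
    (h3 : ∀ j : Fin k, ∑ i, z i ^ ((j : ℕ) + 1) ≡ ∑ i, w i ^ ((j : ℕ) + 1) [ZMOD (p : ℤ) ^ M]) :
    ∀ i, z i ≡ w i [ZMOD (p : ℤ) ^ M] := by
  have : Fact p.Prime := ⟨hp⟩
  have hp0 : (p : ℤ) ≠ 0 := by exact_mod_cast hp.ne_zero
  have key : ∀ r : ℕ, r + 1 ≤ M → ∀ i, z i ≡ w i [ZMOD (p : ℤ) ^ (r + 1)] := by
    intro r
    induction r with
    | zero => intro _ i; simpa using h1 i
    | succ r ih =>
      intro hr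
      have ih' := ih (by omega)
      have hu : ∀ i, ∃ u : ℤ, w i = z i + (p : ℤ) ^ (r + 1) * u := by
        intro i
        obtain ⟨u, hu⟩ := (ih' i).dvd
        exact ⟨u, by linarith⟩
      choose u hu using hu
      have hz : ∀ j : Fin k, ∑ i, ((u i : ZMod p)) * ((z i : ZMod p)) ^ (j : ℕ) = 0 := by
        intro j
        have hd : (p : ℤ) ^ (r + 2) ∣ ∑ i, w i ^ ((j : ℕ) + 1) - ∑ i, z i ^ ((j : ℕ) + 1) :=
          (pow_dvd_pow _ (by omega : r + 2 ≤ M)).trans (h3 j).dvd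
        have hexp : ∀ i, ∃ q : ℤ, w i ^ ((j : ℕ) + 1) - z i ^ ((j : ℕ) + 1) =
            (p : ℤ) ^ (r + 1) * (((j : ℕ) + 1 : ℕ) * (u i * z i ^ (j : ℕ))) + (p : ℤ) ^ (r + 2) * q := by
          intro i
          obtain ⟨q, hq⟩ := Polynomial.powAddExpansion (z i) ((p : ℤ) ^ (r + 1) * u i) ((j : ℕ) + 1)
          refine ⟨q * u i ^ 2 * (p : ℤ) ^ r, ?_⟩
          rw [hu i, hq]
          simp only [Nat.add_sub_cancel]
          ring
        choose q hq using hexp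
        rw [← Finset.sum_sub_distrib] at hd
        simp_rw [hq] at hd
        rw [Finset.sum_add_distrib, ← Finset.mul_sum, ← Finset.mul_sum, ← Finset.mul_sum] at hd
        have hd2 : (p : ℤ) ^ (r + 2) ∣ (p : ℤ) ^ (r + 1) *
            ((((j : ℕ) + 1 : ℕ) : ℤ) * ∑ i, u i * z i ^ (j : ℕ)) :=
          (Int.dvd_add_left (Dvd.intro _ rfl)).1 hd
        rw [pow_succ (p : ℤ) (r + 1)] at hd2
        have hd3 := (mul_dvd_mul_iff_left (pow_ne_zero (r + 1) hp0)).1 hd2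
        rcases (Nat.prime_iff_prime_int.1 hp).dvd_or_dvd hd3 with h | h
        · exfalso
          have := Nat.le_of_dvd (Nat.succ_pos _) (Int.natCast_dvd_natCast.1 h)
          have := j.2
          omega
        · have := (ZMod.intCast_zmod_eq_zero_iff_dvd _ p).2 h
          push_cast at this
          exact this
      have hdet : (Matrix.vandermonde (fun i => (z i : ZMod p))).det ≠ 0 := by
        rw [Matrix.det_vandermonde_ne_zero_iff]
        intro i j hij
        by_contra hne
        exact h2 i j hne ((ZMod.intCast_eq_intCast_iff _ _ _).1 hij)
      have hu0 := Matrix.eq_zero_of_vecMul_eq_zero hdet (v := fun i => (u i : ZMod p)) (by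
        ext j
        simp only [Matrix.vecMul, dotProduct, Matrix.vandermonde_apply, Pi.zero_apply]
        exact hz j)
      intro i
      have := congrFun hu0 i
      simp only [Pi.zero_apply] at this
      obtain ⟨v, hv⟩ := (ZMod.intCast_zmod_eq_zero_iff_dvd _ p).1 this
      rw [Int.modEq_iff_dvd]
      exact ⟨v, by rw [hu i, hv]; ring⟩
  rcases M with _ | M
  · intro i; simp [Int.modEq_one]
  · exact key M le_rfl

lemma dig_inj {p : ℕ} (L M : ℕ) (hLM : L ≤ M) (N N' : ℤ)
    (h : N ≡ N' [ZMOD (p : ℤ) ^ L])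
    (hd : (N % (p : ℤ) ^ M) / (p : ℤ) ^ L = (N' % (p : ℤ) ^ M) / (p : ℤ) ^ L) :
    N ≡ N' [ZMOD (p : ℤ) ^ M] := by
  have h1 : (N % (p : ℤ) ^ M) % (p : ℤ) ^ L = (N' % (p : ℤ) ^ M) % (p : ℤ) ^ L := by
    rw [Int.emod_emod_of_dvd _ (pow_dvd_pow _ hLM), Int.emod_emod_of_dvd _ (pow_dvd_pow _ hLM)]
    exact h
  have h2 := Int.emod_add_mul_ediv (N % (p : ℤ) ^ M) ((p : ℤ) ^ L)
  have h3 := Int.emod_add_mul_ediv (N' % (p : ℤ) ^ M) ((p : ℤ) ^ L)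
  rw [h1, hd] at h2
  exact h2.symm.trans h3

lemma dig_mem {p : ℕ} (hp : 0 < p) (L M : ℕ) (hLM : L ≤ M) (N : ℤ) :
    (N % (p : ℤ) ^ M) / (p : ℤ) ^ L ∈ Finset.Ico (0 : ℤ) ((p : ℤ) ^ (M - L)) := by
  have hp' : (0 : ℤ) < p := by exact_mod_cast hp
  rw [Finset.mem_Ico]
  constructor
  · exact Int.ediv_nonneg (Int.emod_nonneg _ (by positivity)) (by positivity)
  · apply Int.ediv_lt_of_lt_mul (by positivity)
    rw [← pow_add, Nat.sub_add_cancel hLM]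
    exact Int.emod_lt_of_pos _ (by positivity)

noncomputable def cls (p n a : ℕ) (ξ : ℤ) : Finset ℤ :=
  (Finset.Ico (0 : ℤ) ((p : ℤ) ^ n)).filter (fun x => x ≡ ξ [ZMOD (p : ℤ) ^ a])

lemma mem_cls {p n a : ℕ} {ξ x : ℤ} :
    x ∈ cls p n a ξ ↔ (0 ≤ x ∧ x < (p : ℤ) ^ n) ∧ x ≡ ξ [ZMOD (p : ℤ) ^ a] := by
  simp [cls]

lemma cls_eq_of_modEq {p n : ℕ} {x y : ℤ} (hx : 0 ≤ x ∧ x < (p : ℤ) ^ n)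
    (hy : 0 ≤ y ∧ y < (p : ℤ) ^ n) (h : x ≡ y [ZMOD (p : ℤ) ^ n]) : x = y := by
  unfold Int.ModEq at h
  rwa [Int.emod_eq_of_lt hx.1 hx.2, Int.emod_eq_of_lt hy.1 hy.2] at h

lemma card_cls {p : ℕ} (hp : 0 < p) (m a : ℕ) (ham : a ≤ m) (ξ : ℤ) :
    #(cls p m a ξ) ≤ p ^ (m - a) := by
  have hcard : #(Finset.Ico (0 : ℤ) ((p : ℤ) ^ (m - a))) = p ^ (m - a) := by
    rw [Int.card_Ico, sub_zero]
    exact_mod_cast Int.toNat_natCast (p ^ (m - a))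
  rw [← hcard]
  apply Finset.card_le_card_of_injOn (fun x => (x % (p : ℤ) ^ m) / (p : ℤ) ^ a)
  · intro x _
    exact dig_mem hp a m ham x
  · intro x hx y hy hxy
    rw [Finset.mem_coe, mem_cls] at hx hy
    exact cls_eq_of_modEq hx.1 hy.1 (dig_inj a m ham x y (hx.2.trans hy.2.symm) hxy)

lemma sum_exp (k b c : ℕ) :
    ∑ j : Fin k, ((k * b - ((j : ℕ) + 1) * b) + c * (j : ℕ)) = (b + c) * (k * (k - 1) / 2) := by
  have h1 : ∑ j : Fin k, c * (j : ℕ) = c * (k * (k - 1) / 2) := by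
    rw [← Finset.mul_sum, Fin.sum_univ_eq_sum_range (fun i => i) k, Finset.sum_range_id]
  have h2 : ∑ j : Fin k, (k * b - ((j : ℕ) + 1) * b) = b * (k * (k - 1) / 2) := by
    rw [Fin.sum_univ_eq_sum_range (fun i => k * b - (i + 1) * b) k,
      ← Finset.sum_range_reflect, ← Finset.sum_range_id, Finset.mul_sum]
    apply Finset.sum_congr rfl
    intro j hj
    rw [Finset.mem_range] at hj
    have : k - 1 - j + 1 = k - j := by omega
    rw [this, ← Nat.sub_mul]
    have : k - (k - j) = j := by omega
    rw [this, mul_comm]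
  rw [Finset.sum_add_distrib, h1, h2]
  ring

lemma fiber_bound {k p : ℕ} (hk : 1 ≤ k) (hp : p.Prime) (hkp : k < p) (b c : ℕ) (hcb : k * c ≤ b)
    (ζ : Fin k → ℤ) (hζ1 : ∀ i j, ζ i ≡ ζ j [ZMOD (p : ℤ) ^ c])
    (hζ2 : ∀ i j, i ≠ j → ¬ ζ i ≡ ζ j [ZMOD (p : ℤ) ^ (c + 1)]) (η : ℤ)
    (S : Finset (Fin k → ℤ))
    (hS : S ⊆ Fintype.piFinset (fun i => cls p (k * b) (c + 1) (ζ i)))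
    (hSS : ∀ θ ∈ S, ∀ θ' ∈ S, ∀ j : Fin k, ∑ i, (θ i - η) ^ ((j : ℕ) + 1) ≡
      ∑ i, (θ' i - η) ^ ((j : ℕ) + 1) [ZMOD (p : ℤ) ^ (((j : ℕ) + 1) * b)]) :
    #S ≤ p ^ ((b + c) * (k * (k - 1) / 2)) := by
  have hp0 : (p : ℤ) ≠ 0 := by exact_mod_cast hp.ne_zero
  set ξ := ζ ⟨0, hk⟩ with hξ
  have hcb' : c ≤ b := le_trans (Nat.le_mul_of_pos_left c hk) hcb
  have hbk : b ≤ k * b := Nat.le_mul_of_pos_left b hk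
  have hkcb : k * c ≤ k * b := by omega
  set zz : (Fin k → ℤ) → Fin k → ℤ := fun θ i => (θ i - ξ) / (p : ℤ) ^ c with hzz
  have hmem : ∀ θ ∈ S, ∀ i, (0 ≤ θ i ∧ θ i < (p : ℤ) ^ (k * b)) ∧
      θ i ≡ ζ i [ZMOD (p : ℤ) ^ (c + 1)] := by
    intro θ hθ i
    exact mem_cls.1 (Fintype.mem_piFinset.1 (hS hθ) i)
  have hz : ∀ θ ∈ S, ∀ i, θ i - ξ = (p : ℤ) ^ c * zz θ i := by
    intro θ hθ i
    have h1 : θ i ≡ ξ [ZMOD (p : ℤ) ^ c] :=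
      ((hmem θ hθ i).2.of_dvd (pow_dvd_pow _ (by omega))).trans (hζ1 _ _)
    rw [hzz]
    exact (Int.mul_ediv_cancel' h1.symm.dvd).symm
  let code : (Fin k → ℤ) → Fin k → ℤ × ℤ := fun θ j =>
    (((∑ i, (θ i - η) ^ ((j : ℕ) + 1)) % (p : ℤ) ^ (k * b)) / (p : ℤ) ^ (((j : ℕ) + 1) * b),
     ((∑ i, (zz θ i) ^ ((j : ℕ) + 1)) % (p : ℤ) ^ (k * b - c)) /
        (p : ℤ) ^ (k * b - c * ((j : ℕ) + 1)))
  have hj1 : ∀ j : Fin k, ((j : ℕ) + 1) * b ≤ k * b := fun j => Nat.mul_le_mul_right _ j.2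
  have hj2 : ∀ j : Fin k, c * ((j : ℕ) + 1) ≤ k * b := fun j => by
    calc c * ((j : ℕ) + 1) ≤ c * k := Nat.mul_le_mul_left _ j.2
      _ = k * c := mul_comm _ _
      _ ≤ k * b := hkcb
  have hj3 : ∀ j : Fin k, k * b - c * ((j : ℕ) + 1) ≤ k * b - c := fun j => by
    have : c ≤ c * ((j : ℕ) + 1) := Nat.le_mul_of_pos_right c (by omega)
    omega
  have hcard : #(Fintype.piFinset (fun j : Fin k =>
      Finset.Ico (0 : ℤ) ((p : ℤ) ^ (k * b - ((j : ℕ) + 1) * b)) ×ˢ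
      Finset.Ico (0 : ℤ) ((p : ℤ) ^ (c * (j : ℕ))))) = p ^ ((b + c) * (k * (k - 1) / 2)) := by
    rw [Fintype.card_piFinset, ← sum_exp k b c, ← Finset.prod_pow_eq_pow_sum]
    apply Finset.prod_congr rfl
    intro j _
    rw [Finset.card_product, Int.card_Ico, Int.card_Ico, sub_zero, sub_zero, pow_add]
    have hh : ∀ a : ℕ, ((p : ℤ) ^ a).toNat = p ^ a := fun a => by
      exact_mod_cast Int.toNat_natCast (p ^ a)
    rw [hh, hh]
  rw [← hcard]
  apply Finset.card_le_card_of_injOn code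
  · intro θ _
    rw [Finset.mem_coe, Fintype.mem_piFinset]
    intro j
    rw [Finset.mem_product]
    constructor
    · exact dig_mem hp.pos _ _ (hj1 j) _
    · have := dig_mem hp.pos _ _ (hj3 j) (∑ i, (zz θ i) ^ ((j : ℕ) + 1))
      have e : k * b - c - (k * b - c * ((j : ℕ) + 1)) = c * (j : ℕ) := by
        have := hj2 j
        have e2 : c * ((j : ℕ) + 1) = c * (j : ℕ) + c := by ring
        omega
      rw [e] at this
      exact this
  · intro θ hθ θ' hθ' heq
    rw [Finset.mem_coe] at hθ hθ'
    have hP : ∀ j : Fin k, ∑ i, (θ i - η) ^ ((j : ℕ) + 1) ≡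
        ∑ i, (θ' i - η) ^ ((j : ℕ) + 1) [ZMOD (p : ℤ) ^ (k * b)] := by
      intro j
      exact dig_inj _ _ (hj1 j) _ _ (hSS θ hθ θ' hθ' j) (congrArg Prod.fst (congrFun heq j))
    have hP2 : ∀ j : Fin k, ∑ i, (θ i - ξ) ^ ((j : ℕ) + 1) ≡
        ∑ i, (θ' i - ξ) ^ ((j : ℕ) + 1) [ZMOD (p : ℤ) ^ (k * b)] := by
      intro j
      have hcast : ((p : ℤ) ^ (k * b)) = ((p ^ (k * b) : ℕ) : ℤ) := by push_cast; rfl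
      rw [hcast] at hP ⊢
      rw [cast_pow_sum_iff]
      have hP' := fun j => (cast_pow_sum_iff _ _ _ _).1 (hP j)
      have := shift_eq hP' ((η : ZMod (p ^ (k * b))) - ξ) ((j : ℕ) + 1) j.2
      push_cast at this ⊢
      simpa using this
    have hP3 : ∀ j : Fin k, ∑ i, (zz θ i) ^ ((j : ℕ) + 1) ≡
        ∑ i, (zz θ' i) ^ ((j : ℕ) + 1) [ZMOD (p : ℤ) ^ (k * b - c)] := by
      intro j
      apply dig_inj _ _ (hj3 j) _ _ _ (congrArg Prod.snd (congrFun heq j))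
      have h4 := (hP2 j).dvd
      simp_rw [hz θ hθ, hz θ' hθ', mul_pow] at h4
      rw [← Finset.mul_sum, ← Finset.mul_sum, ← mul_sub, ← pow_mul] at h4
      have e : k * b = c * ((j : ℕ) + 1) + (k * b - c * ((j : ℕ) + 1)) := by
        have := hj2 j; omega
      rw [e, pow_add] at h4
      exact Int.modEq_iff_dvd.2 ((mul_dvd_mul_iff_left (pow_ne_zero _ hp0)).1 h4)
    have hdiff : ∀ i j, ∀ θ ∈ S, ∀ θ' ∈ S, θ i - θ' j = (p : ℤ) ^ c * (zz θ i - zz θ' j) := by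
      intro i j θ hθ θ' hθ'
      have := hz θ hθ i
      have := hz θ' hθ' j
      linear_combination hz θ hθ i - hz θ' hθ' j
    have hH := hensel hp hkp (k * b - c) (zz θ) (zz θ') (by
        intro i
        have h5 : θ i ≡ θ' i [ZMOD (p : ℤ) ^ (c + 1)] :=
          (hmem θ hθ i).2.trans (hmem θ' hθ' i).2.symm
        have h6 := h5.symm.dvd
        rw [hdiff i i θ hθ θ' hθ', pow_succ] at h6
        exact (Int.modEq_iff_dvd.2 ((mul_dvd_mul_iff_left (pow_ne_zero _ hp0)).1 h6)).symm) (by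
        intro i j hij hcon
        apply hζ2 i j hij
        refine (hmem θ hθ i).2.symm.trans (Int.ModEq.trans ?_ (hmem θ hθ j).2)
        apply Int.ModEq.symm
        rw [Int.modEq_iff_dvd, hdiff i j θ hθ θ hθ, pow_succ]
        exact mul_dvd_mul_left _ hcon.symm.dvd) hP3
    funext i
    apply cls_eq_of_modEq (hmem θ hθ i).1 (hmem θ' hθ' i).1
    apply Int.ModEq.symm
    rw [Int.modEq_iff_dvd, hdiff i i θ hθ θ' hθ']
    have e : k * b = c + (k * b - c) := by omega
    rw [e, pow_add]
    exact mul_dvd_mul_left _ (hH i).symm.dvd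

end Arith

end VMV


namespace VMV

open Finset

section Exp

variable {k Q : ℕ} [NeZero Q]

def mom (k : ℕ) (x : ℤ) : Fin k → ℤ := fun j => x ^ ((j : ℕ) + 1)

noncomputable def f (A : Finset ℤ) (α : Fin k → ZMod Q) : ℂ := ∑ x ∈ A, ch α (mom k x)

lemma mom_sum {ι : Type*} [Fintype ι] (x : ι → ℤ) (j : Fin k) :
    (∑ i, mom k (x i)) j = ∑ i, x i ^ ((j : ℕ) + 1) := by
  simp [mom]

lemma prod_f {ι : Type*} [Fintype ι] [DecidableEq ι] (A : ι → Finset ℤ) (α : Fin k → ZMod Q) :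
    ∏ i, f (A i) α = ∑ x ∈ Fintype.piFinset A, ch α (∑ i, mom k (x i)) := by
  unfold f
  rw [Finset.prod_univ_sum]
  apply Finset.sum_congr rfl
  intro x _
  rw [ch_sum]

lemma f_split {p : ℕ} (hp : 0 < p) (n a m : ℕ) (ham : a ≤ m) (ξ : ℤ) (α : Fin k → ZMod Q) :
    f (cls p n a ξ) α = ∑ θ ∈ cls p m a ξ, f (cls p n m θ) α := by
  have hp' : (0 : ℤ) < p := by exact_mod_cast hp
  unfold f
  rw [← Finset.sum_fiberwise_of_maps_to (s := cls p n a ξ) (t := cls p m a ξ)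
    (g := fun x => x % (p : ℤ) ^ m)]
  · apply Finset.sum_congr rfl
    intro θ hθ
    apply Finset.sum_congr _ fun _ _ => rfl
    rw [mem_cls] at hθ
    ext x
    rw [Finset.mem_filter, mem_cls, mem_cls]
    constructor
    · rintro ⟨⟨h1, h2⟩, h3⟩
      refine ⟨h1, ?_⟩
      rw [← h3]
      exact (Int.mod_modEq _ _).symm
    · rintro ⟨h1, h2⟩
      refine ⟨⟨h1, (h2.of_dvd (pow_dvd_pow _ ham)).trans hθ.2⟩, ?_⟩
      rw [h2, Int.emod_eq_of_lt hθ.1.1 hθ.1.2]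
  · intro x hx
    rw [mem_cls] at hx ⊢
    refine ⟨⟨Int.emod_nonneg _ (by positivity), Int.emod_lt_of_pos _ (by positivity)⟩, ?_⟩
    exact ((Int.mod_modEq x ((p : ℤ) ^ m)).of_dvd (pow_dvd_pow _ ham)).trans hx.2

/-- integral solutions of the Vinogradov system with variables in `A` -/
noncomputable def sols (k t : ℕ) (A : Finset ℤ) : Finset ((Fin t → ℤ) × (Fin t → ℤ)) :=
  ((Fintype.piFinset fun _ => A) ×ˢ (Fintype.piFinset fun _ => A)).filter fun q =>
    ∀ j : Fin k, ∑ i, q.1 i ^ ((j : ℕ) + 1) = ∑ i, q.2 i ^ ((j : ℕ) + 1)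

noncomputable def J (k t : ℕ) (X : ℕ) : ℕ := #(sols k t (Finset.Ico (0 : ℤ) X))

lemma int_of_zmod {a b : ℤ} (ha : 0 ≤ a) (ha' : a < Q) (hb : 0 ≤ b) (hb' : b < Q)
    (h : (a : ZMod Q) = (b : ZMod Q)) : a = b := by
  have := (ZMod.intCast_eq_intCast_iff a b Q).1 h
  unfold Int.ModEq at this
  rwa [Int.emod_eq_of_lt ha ha', Int.emod_eq_of_lt hb hb'] at this

lemma pow_sum_bound {ι : Type*} [Fintype ι] (X : ℕ) (x : ι → ℤ)
    (hx : ∀ i, 0 ≤ x i ∧ x i < X) (hQ : Fintype.card ι * X ^ k < Q) (j : Fin k) :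
    0 ≤ ∑ i, x i ^ ((j : ℕ) + 1) ∧ ∑ i, x i ^ ((j : ℕ) + 1) < Q := by
  constructor
  · exact Finset.sum_nonneg fun i _ => pow_nonneg (hx i).1 _
  · have : ∑ i, x i ^ ((j : ℕ) + 1) ≤ ∑ _i : ι, (X : ℤ) ^ k := by
      apply Finset.sum_le_sum
      intro i _
      have h1 := hx i
      calc x i ^ ((j : ℕ) + 1) ≤ (X : ℤ) ^ ((j : ℕ) + 1) := by
            apply pow_le_pow_left₀ h1.1 h1.2.le
        _ ≤ (X : ℤ) ^ k := by
            apply pow_le_pow_right₀ _ j.2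
            omega
    refine this.trans_lt ?_
    simp only [Finset.sum_const, Finset.card_univ, nsmul_eq_mul]
    exact_mod_cast hQ

lemma wrap (t X : ℕ) (A : Finset ℤ) (hA : ∀ x ∈ A, 0 ≤ x ∧ x < X) (hQ : t * X ^ k < Q)
    (a : ℤ → ℂ) (ha : ∀ x, ‖a x‖ ≤ 1) :
    E (fun α : Fin k → ZMod Q => ‖∑ x ∈ A, a x * ch α (mom k x)‖ ^ (2 * t)) ≤
      (#(sols k t A) : ℝ) := by
  have h : ∀ α : Fin k → ZMod Q, ‖∑ x ∈ A, a x * ch α (mom k x)‖ ^ (2 * t) =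
      ‖∑ x ∈ Fintype.piFinset (fun _ : Fin t => A), (∏ i, a (x i)) *
        ch α (∑ i, mom k (x i))‖ ^ 2 := by
    intro α
    rw [mul_comm 2 t, pow_mul, ← norm_pow]
    congr 2
    have : (∑ x ∈ A, a x * ch α (mom k x)) ^ t =
      ∏ _i : Fin t, (∑ x ∈ A, a x * ch α (mom k x)) := by simp
    rw [this, Finset.prod_univ_sum]
    apply Finset.sum_congr rfl
    intro x _
    rw [ch_sum, Finset.prod_mul_distrib]
  simp_rw [h]
  refine (E_sq_coef _ _ _ ?_).trans ?_
  · intro z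
    rw [norm_prod]
    exact Finset.prod_le_one (fun _ _ => norm_nonneg _) fun i _ => ha _
  · apply Nat.cast_le.2
    apply Finset.card_le_card
    intro q hq
    unfold sols
    rw [Finset.mem_filter] at hq ⊢
    refine ⟨hq.1, fun j => ?_⟩
    have h1 := hq.2 j
    rw [mom_sum, mom_sum] at h1
    have h2 := Finset.mem_product.1 hq.1
    have b1 := pow_sum_bound (k := k) (Q := Q) X q.1
      (fun i => hA _ (Fintype.mem_piFinset.1 h2.1 i)) (by simpa using hQ) j
    have b2 := pow_sum_bound (k := k) (Q := Q) X q.2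
      (fun i => hA _ (Fintype.mem_piFinset.1 h2.2 i)) (by simpa using hQ) j
    exact int_of_zmod b1.1 b1.2 b2.1 b2.2 h1

lemma Jcls {p : ℕ} (hp : 0 < p) (n a t : ℕ) (han : a ≤ n) (ξ : ℤ) (hQ : t * (p ^ n) ^ k < Q) :
    E (fun α : Fin k → ZMod Q => ‖f (cls p n a ξ) α‖ ^ (2 * t)) ≤ (J k t (p ^ (n - a)) : ℝ) := by
  have hp' : (0 : ℤ) < p := by exact_mod_cast hp
  have h := wrap (k := k) (Q := Q) t (p ^ n) (cls p n a ξ) (by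
    intro x hx; have := (mem_cls.1 hx).1; push_cast; exact this) hQ (fun _ => 1) (by simp)
  simp only [one_mul] at h
  refine h.trans ?_
  apply Nat.cast_le.2
  have hdec : ∀ x ∈ cls p n a ξ, x + (- (ξ % (p : ℤ) ^ a)) = (p : ℤ) ^ a * (x / (p : ℤ) ^ a) := by
    intro x hx
    have h1 := (mem_cls.1 hx).2
    have h2 := Int.emod_add_mul_ediv x ((p : ℤ) ^ a)
    unfold Int.ModEq at h1
    rw [← h1]
    linarith
  unfold J
  apply Finset.card_le_card_of_injOn
    (fun q => (fun i => q.1 i / (p : ℤ) ^ a, fun i => q.2 i / (p : ℤ) ^ a))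
  · intro q hq
    rw [Finset.mem_coe] at hq ⊢
    unfold sols at hq ⊢
    rw [Finset.mem_filter, Finset.mem_product, Fintype.mem_piFinset, Fintype.mem_piFinset] at hq ⊢
    have hr : ∀ x ∈ cls p n a ξ, x / (p : ℤ) ^ a ∈ Finset.Ico (0 : ℤ) ((p ^ (n - a) : ℕ) : ℤ) := by
      intro x hx
      have h1 := (mem_cls.1 hx).1
      rw [Finset.mem_Ico]
      constructor
      · exact Int.ediv_nonneg h1.1 (by positivity)
      · apply Int.ediv_lt_of_lt_mul (by positivity)
        push_cast
        rw [← pow_add, Nat.sub_add_cancel han]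
        exact h1.2
    refine ⟨⟨fun i => hr _ (hq.1.1 i), fun i => hr _ (hq.1.2 i)⟩, ?_⟩
    intro j
    have h3 := shift_eq hq.2 (- (ξ % (p : ℤ) ^ a)) ((j : ℕ) + 1) j.2
    simp_rw [hdec _ (hq.1.1 _), hdec _ (hq.1.2 _), mul_pow] at h3
    rw [← Finset.mul_sum, ← Finset.mul_sum] at h3
    exact mul_left_cancel₀ (by positivity) h3
  · intro q hq q' hq' heq
    rw [Finset.mem_coe] at hq hq'
    unfold sols at hq hq'
    rw [Finset.mem_filter, Finset.mem_product, Fintype.mem_piFinset, Fintype.mem_piFinset] at hq hq'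
    have hinj : ∀ x ∈ cls p n a ξ, ∀ y ∈ cls p n a ξ, x / (p : ℤ) ^ a = y / (p : ℤ) ^ a → x = y := by
      intro x hx y hy hxy
      have h1 := hdec x hx
      have h2 := hdec y hy
      rw [hxy] at h1
      linarith
    simp only [Prod.mk.injEq] at heq
    ext i
    · exact hinj _ (hq.1.1 i) _ (hq'.1.1 i) (congrFun heq.1 i)
    · exact hinj _ (hq.1.2 i) _ (hq'.1.2 i) (congrFun heq.2 i)

end Exp

end VMV


namespace VMV

open Finset

section Congr

variable {k Q : ℕ} [NeZero Q]

lemma congr_step {p : ℕ} (hk : 1 ≤ k) (hp : p.Prime) (hkp : k < p) (n b c : ℕ) (hcb : k * c ≤ b)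
    (hckb : c + 1 ≤ k * b)
    (ζ : Fin k → ℤ) (hζ1 : ∀ i j, ζ i ≡ ζ j [ZMOD (p : ℤ) ^ c])
    (hζ2 : ∀ i j, i ≠ j → ¬ ζ i ≡ ζ j [ZMOD (p : ℤ) ^ (c + 1)]) (η : ℤ)
    {ι : Type} [Fintype ι] [DecidableEq ι] (B : ι → Finset ℤ)
    (hB : ∀ l, ∀ y ∈ B l, (0 ≤ y ∧ y < (p : ℤ) ^ n) ∧ y ≡ η [ZMOD (p : ℤ) ^ b])
    (hQ : (k + Fintype.card ι) * (p ^ n) ^ k < Q) :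
    E (fun α : Fin k → ZMod Q => (∏ i, ‖f (cls p n (c + 1) (ζ i)) α‖ ^ 2) *
        ∏ l, ‖f (B l) α‖ ^ 2) ≤
      (p : ℝ) ^ ((b + c) * (k * (k - 1) / 2)) *
        ∑ θ ∈ Fintype.piFinset (fun i => cls p (k * b) (c + 1) (ζ i)),
          E (fun α : Fin k → ZMod Q => (∏ i, ‖f (cls p n (k * b) (θ i)) α‖ ^ 2) *
            ∏ l, ‖f (B l) α‖ ^ 2) := by
  have hp' : (0 : ℤ) < p := by exact_mod_cast hp.pos
  set A' : Fin k ⊕ ι → Finset ℤ := Sum.elim (fun i => cls p n (c + 1) (ζ i)) B with hA'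
  set Θ := Fintype.piFinset (fun i => cls p (k * b) (c + 1) (ζ i)) with hΘ
  let κ' : (Fin k → ℤ) → Fin k → ℤ := fun θ j =>
    (∑ i, (θ i - η) ^ ((j : ℕ) + 1)) % (p : ℤ) ^ (((j : ℕ) + 1) * b)
  let κ : (Fin k ⊕ ι → ℤ) → Fin k → ℤ := fun z => κ' (fun i => z (Sum.inl i))
  let red : (Fin k ⊕ ι → ℤ) → Fin k → ℤ := fun z i => z (Sum.inl i) % (p : ℤ) ^ (k * b)
  have hform : ∀ (α : Fin k → ZMod Q) (θ : Fin k → Finset ℤ),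
      (∏ i, ‖f (θ i) α‖ ^ 2) * ∏ l, ‖f (B l) α‖ ^ 2 =
      ‖∑ z ∈ Fintype.piFinset (Sum.elim θ B), ch α (∑ s, mom k (z s))‖ ^ 2 := by
    intro α θ
    rw [← prod_f, Fintype.prod_sum_type, norm_mul, mul_pow, norm_prod, norm_prod,
      Finset.prod_pow, Finset.prod_pow]
    rfl
  have hZmem : ∀ z ∈ Fintype.piFinset A', (∀ i, z (Sum.inl i) ∈ cls p n (c + 1) (ζ i)) ∧
      ∀ l, z (Sum.inr l) ∈ B l := by
    intro z hz
    rw [Fintype.mem_piFinset] at hz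
    exact ⟨fun i => hz (Sum.inl i), fun l => hz (Sum.inr l)⟩
  have hκ'congr : ∀ θ θ' : Fin k → ℤ, (∀ i, θ i ≡ θ' i [ZMOD (p : ℤ) ^ (k * b)]) →
      κ' θ = κ' θ' := by
    intro θ θ' h
    funext j
    change _ ≡ _ [ZMOD _]
    apply Int.ModEq.of_dvd (pow_dvd_pow _ (Nat.mul_le_mul_right b j.2))
    have : ∀ s : Finset (Fin k), ∑ i ∈ s, (θ i - η) ^ ((j : ℕ) + 1) ≡
        ∑ i ∈ s, (θ' i - η) ^ ((j : ℕ) + 1) [ZMOD (p : ℤ) ^ (k * b)] := by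
      intro s
      induction s using Finset.induction_on with
      | empty => simp
      | insert a s has ih =>
        rw [Finset.sum_insert has, Finset.sum_insert has]
        exact (((h a).sub_right η).pow _).add ih
    exact this _
  have hredmod : ∀ z i, z (Sum.inl i) ≡ red z i [ZMOD (p : ℤ) ^ (k * b)] := fun z i =>
    (Int.mod_modEq _ _).symm
  have hκred : ∀ z, κ z = κ' (red z) := fun z => hκ'congr _ _ (hredmod z)
  have hredmem : ∀ z ∈ Fintype.piFinset A', red z ∈ Θ := by
    intro z hz
    rw [hΘ, Fintype.mem_piFinset]
    intro i
    rw [mem_cls]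
    refine ⟨⟨Int.emod_nonneg _ (by positivity), Int.emod_lt_of_pos _ (by positivity)⟩, ?_⟩
    exact ((hredmod z i).symm.of_dvd (pow_dvd_pow _ hckb)).trans (mem_cls.1 ((hZmem z hz).1 i)).2
  have hdec := E_sq_decomp (Q := Q) (Fintype.piFinset A') (fun z => ∑ s, mom k (z s)) κ
    (Θ.image κ') (by
      intro z hz
      rw [hκred]
      exact Finset.mem_image_of_mem _ (hredmem z hz)) (by
      intro z hz w hw h
      have hbd : ∀ z ∈ Fintype.piFinset A', ∀ s, 0 ≤ z s ∧ z s < ((p ^ n : ℕ) : ℤ) := by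
        intro z hz s
        push_cast
        rcases s with i | l
        · exact (mem_cls.1 ((hZmem z hz).1 i)).1
        · exact (hB l _ ((hZmem z hz).2 l)).1
      have hintg : ∀ j : Fin k, ∑ s, z s ^ ((j : ℕ) + 1) = ∑ s, w s ^ ((j : ℕ) + 1) := by
        intro j
        have h1 := h j
        simp only [mom_sum] at h1
        have b1 := pow_sum_bound (k := k) (Q := Q) (p ^ n) z (hbd z hz) (by simpa using hQ) j
        have b2 := pow_sum_bound (k := k) (Q := Q) (p ^ n) w (hbd w hw) (by simpa using hQ) j
        exact int_of_zmod b1.1 b1.2 b2.1 b2.2 h1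
      funext j
      have h2 := shift_eq hintg (-η) ((j : ℕ) + 1) j.2
      rw [Fintype.sum_sum_type, Fintype.sum_sum_type] at h2
      have hBz : ∀ z ∈ Fintype.piFinset A', (p : ℤ) ^ (((j : ℕ) + 1) * b) ∣
          ∑ l, (z (Sum.inr l) + -η) ^ ((j : ℕ) + 1) := by
        intro z hz
        apply Finset.dvd_sum
        intro l _
        rw [mul_comm, pow_mul]
        apply pow_dvd_pow_of_dvd
        exact (hB l _ ((hZmem z hz).2 l)).2.symm.dvd
      change _ ≡ _ [ZMOD _]
      apply Int.ModEq.symm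
      rw [Int.modEq_iff_dvd]
      have h3 := (dvd_sub (hBz w hw) (hBz z hz))
      have h4 : ∑ l, (w (Sum.inr l) + -η) ^ ((j : ℕ) + 1) - ∑ l, (z (Sum.inr l) + -η) ^ ((j : ℕ) + 1)
          = ∑ i, (z (Sum.inl i) + -η) ^ ((j : ℕ) + 1) -
            ∑ i, (w (Sum.inl i) + -η) ^ ((j : ℕ) + 1) := by linarith
      rw [h4] at h3
      simpa only [sub_eq_add_neg] using h3)
  have hL : E (fun α : Fin k → ZMod Q => (∏ i, ‖f (cls p n (c + 1) (ζ i)) α‖ ^ 2) *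
        ∏ l, ‖f (B l) α‖ ^ 2) = E (fun α : Fin k → ZMod Q =>
        ‖∑ z ∈ Fintype.piFinset A', ch α (∑ s, mom k (z s))‖ ^ 2) := by
    congr 1
    funext α
    exact hform α (fun i => cls p n (c + 1) (ζ i))
  rw [hL, hdec]
  rw [← Finset.sum_fiberwise_of_maps_to (s := Θ) (t := Θ.image κ') (g := κ')
    (fun θ hθ => Finset.mem_image_of_mem _ hθ), Finset.mul_sum]
  apply Finset.sum_le_sum
  intro m hm
  rw [← E_sum, ← E_mul]
  apply E_mono
  intro α
  have hsplit : ∑ z ∈ Fintype.piFinset A' with κ z = m, ch α (∑ s, mom k (z s)) =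
      ∑ θ ∈ Θ with κ' θ = m, ∑ z ∈ Fintype.piFinset (Sum.elim (fun i => cls p n (k * b) (θ i)) B),
        ch α (∑ s, mom k (z s)) := by
    rw [← Finset.sum_fiberwise_of_maps_to (s := {z ∈ Fintype.piFinset A' | κ z = m})
      (t := {θ ∈ Θ | κ' θ = m}) (g := red)]
    · apply Finset.sum_congr rfl
      intro θ hθ
      rw [Finset.mem_filter, hΘ, Fintype.mem_piFinset] at hθ
      apply Finset.sum_congr _ fun _ _ => rfl
      ext z
      rw [Finset.mem_filter, Finset.mem_filter]
      constructor
      · rintro ⟨⟨hz, h1⟩, h2⟩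
        rw [Fintype.mem_piFinset]
        intro s
        rcases s with i | l
        · simp only [Sum.elim_inl]
          rw [mem_cls]
          refine ⟨(mem_cls.1 ((hZmem z hz).1 i)).1, ?_⟩
          rw [← h2]
          exact hredmod z i
        · exact (hZmem z hz).2 l
      · intro h
        rw [Fintype.mem_piFinset] at h
        have hi : ∀ i, z (Sum.inl i) ∈ cls p n (k * b) (θ i) := fun i => h (Sum.inl i)
        have h2 : red z = θ := by
          funext i
          have h3 := (mem_cls.1 (hi i)).2
          change z (Sum.inl i) % (p : ℤ) ^ (k * b) = θ i
          rw [h3]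
          have := (mem_cls.1 (hθ.1 i)).1
          exact Int.emod_eq_of_lt this.1 this.2
        refine ⟨⟨?_, ?_⟩, h2⟩
        · rw [Fintype.mem_piFinset]
          intro s
          rcases s with i | l
          · change z (Sum.inl i) ∈ cls p n (c + 1) (ζ i)
            rw [mem_cls]
            refine ⟨(mem_cls.1 (hi i)).1, ?_⟩
            exact ((mem_cls.1 (hi i)).2.of_dvd (pow_dvd_pow _ hckb)).trans (mem_cls.1 (hθ.1 i)).2
          · exact h (Sum.inr l)
        · rw [hκred, h2]
          exact hθ.2
    · intro z hz
      rw [Finset.mem_filter] at hz ⊢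
      exact ⟨hredmem z hz.1, by rw [← hκred]; exact hz.2⟩
  rw [hsplit]
  have hcardm : (#{θ ∈ Θ | κ' θ = m} : ℝ) ≤ (p : ℝ) ^ ((b + c) * (k * (k - 1) / 2)) := by
    have := fiber_bound hk hp hkp b c hcb ζ hζ1 hζ2 η {θ ∈ Θ | κ' θ = m}
      (Finset.filter_subset _ _) (by
        intro θ hθ θ' hθ' j
        rw [Finset.mem_filter] at hθ hθ'
        exact congrFun (hθ.2.trans hθ'.2.symm) j)
    exact_mod_cast this
  calc ‖∑ θ ∈ Θ with κ' θ = m, ∑ z ∈ Fintype.piFinset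
        (Sum.elim (fun i => cls p n (k * b) (θ i)) B), ch α (∑ s, mom k (z s))‖ ^ 2
      ≤ (∑ θ ∈ Θ with κ' θ = m, ‖∑ z ∈ Fintype.piFinset
        (Sum.elim (fun i => cls p n (k * b) (θ i)) B), ch α (∑ s, mom k (z s))‖) ^ 2 := by
        gcongr
        exact norm_sum_le _ _
    _ ≤ #{θ ∈ Θ | κ' θ = m} * ∑ θ ∈ Θ with κ' θ = m, ‖∑ z ∈ Fintype.piFinset
        (Sum.elim (fun i => cls p n (k * b) (θ i)) B), ch α (∑ s, mom k (z s))‖ ^ 2 :=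
        sq_sum_le_card_mul_sum_sq
    _ ≤ _ := by
        simp_rw [← hform α]
        gcongr

end Congr

end VMV


namespace VMV

open Finset

section VM

def JB (k : ℕ) (lam : ℝ) : Prop :=
  ∃ C : ℝ, 0 < C ∧ ∀ X : ℕ, 1 ≤ X → (J k (k * (k + 1)) X : ℝ) ≤ C * (X : ℝ) ^ lam

def Tr {k : ℕ} (p c : ℕ) (ζ : Fin k → ℤ) : Prop :=
  (∀ i j, ζ i ≡ ζ j [ZMOD (p : ℤ) ^ c]) ∧
    ∀ i j, i ≠ j → ¬ ζ i ≡ ζ j [ZMOD (p : ℤ) ^ (c + 1)]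

def UB (k n c b : ℕ) (e : ℝ) : Prop :=
  ∃ C : ℝ, 0 < C ∧ ∀ p : ℕ, p.Prime → k < p → ∀ (Q : ℕ) [NeZero Q],
    (k * (k + 1)) * (p ^ n) ^ k < Q → ∀ (ζ : Fin k → ℤ) (η : ℤ), Tr p c ζ →
      E (fun α : Fin k → ZMod Q => (∏ i, ‖f (cls p n (c + 1) (ζ i)) α‖ ^ 2) *
        ‖f (cls p n b η) α‖ ^ (k * (2 * k))) ≤ C * (p : ℝ) ^ e

def VB (k n c b : ℕ) (e : ℝ) : Prop :=
  ∃ C : ℝ, 0 < C ∧ ∀ p : ℕ, p.Prime → k < p → ∀ (Q : ℕ) [NeZero Q],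
    (k * (k + 1)) * (p ^ n) ^ k < Q → ∀ (ζ : Fin k → ℤ) (η : ℤ), Tr p c ζ →
    ∀ θ : Fin k → ℤ, Function.Injective θ → (∀ i, θ i ∈ cls p (b + 1) b η) →
      E (fun α : Fin k → ZMod Q => (∏ i, ‖f (cls p n (c + 1) (ζ i)) α‖ ^ 2) *
        ∏ i, ‖f (cls p n (b + 1) (θ i)) α‖ ^ (2 * k)) ≤ C * (p : ℝ) ^ e

lemma UB_mono {k n c b : ℕ} {e e' : ℝ} (h : UB k n c b e) (hee : e ≤ e') : UB k n c b e' := by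
  obtain ⟨C, hC, h⟩ := h
  refine ⟨C, hC, fun p hp hkp Q _ hQ ζ η hT => (h p hp hkp Q hQ ζ η hT).trans ?_⟩
  have : (1 : ℝ) ≤ p := by exact_mod_cast hp.one_lt.le
  gcongr

lemma VB_mono {k n c b : ℕ} {e e' : ℝ} (h : VB k n c b e) (hee : e ≤ e') : VB k n c b e' := by
  obtain ⟨C, hC, h⟩ := h
  refine ⟨C, hC, fun p hp hkp Q _ hQ ζ η hT θ h1 h2 => (h p hp hkp Q hQ ζ η hT θ h1 h2).trans ?_⟩
  have : (1 : ℝ) ≤ p := by exact_mod_cast hp.one_lt.le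
  gcongr

lemma pow_rpow_eq {x : ℝ} (hx : 0 ≤ x) (a m : ℕ) (θ : ℝ) (h : (a : ℝ) * θ = m) :
    (x ^ a) ^ θ = x ^ m := by
  rw [← Real.rpow_natCast_mul hx, h, Real.rpow_natCast]

lemma mulpow {C D p a b θ : ℝ} (hC : 0 < C) (hD : 0 < D) (hp : 0 < p) :
    (C * p ^ a) ^ θ * (D * p ^ b) ^ (1 - θ) =
      C ^ θ * D ^ (1 - θ) * p ^ (a * θ + b * (1 - θ)) := by
  rw [Real.mul_rpow hC.le (by positivity), Real.mul_rpow hD.le (by positivity),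
    ← Real.rpow_mul hp.le, ← Real.rpow_mul hp.le, Real.rpow_add hp]
  ring

lemma JB_pow {k : ℕ} {lam : ℝ} (h : JB k lam) : ∃ C : ℝ, 0 < C ∧ ∀ p : ℕ, 1 ≤ p → ∀ m : ℕ,
    (J k (k * (k + 1)) (p ^ m) : ℝ) ≤ C * (p : ℝ) ^ ((m : ℝ) * lam) := by
  obtain ⟨C, hC, h⟩ := h
  refine ⟨C, hC, fun p hp m => (h _ (Nat.one_le_pow _ _ hp)).trans_eq ?_⟩
  rw [Real.rpow_natCast_mul (Nat.cast_nonneg _)]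
  push_cast
  rfl

lemma J_cls_bound {k : ℕ} {lam : ℝ} (h : JB k lam) (hl : 0 ≤ lam) :
    ∃ C : ℝ, 0 < C ∧ ∀ p : ℕ, 1 ≤ p → ∀ (Q : ℕ) [NeZero Q] (n a b : ℕ), a ≤ n → b ≤ a → ∀ ξ : ℤ,
    (k * (k + 1)) * (p ^ n) ^ k < Q →
    E (fun α : Fin k → ZMod Q => ‖f (cls p n a ξ) α‖ ^ (2 * (k * (k + 1)))) ≤
      C * (p : ℝ) ^ (((n : ℝ) - b) * lam) := by
  obtain ⟨C, hC, h⟩ := JB_pow h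
  refine ⟨C, hC, fun p hp Q _ n a b han hba ξ hQ => ?_⟩
  refine (Jcls hp n a _ han ξ hQ).trans ((h p hp (n - a)).trans ?_)
  have : (1 : ℝ) ≤ p := by exact_mod_cast hp
  rw [Nat.cast_sub han]
  have : (b : ℝ) ≤ a := by exact_mod_cast hba
  gcongr

/-- trivial bound -/
lemma UB_trivial {k : ℕ} (hk : 1 ≤ k) {lam : ℝ} (h : JB k lam) (hl : 0 ≤ lam) (n c b : ℕ)
    (hc : c + 1 ≤ n) (hb : b ≤ n) :
    UB k n c b (n * lam - lam * (k / (k + 1)) * b) := by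
  obtain ⟨C, hC, h⟩ := J_cls_bound h hl
  refine ⟨k * C, by positivity, fun p hp hkp Q _ hQ ζ η hT => ?_⟩
  have hp1 : 1 ≤ p := hp.one_lt.le
  have hpR : (0 : ℝ) < p := by exact_mod_cast hp.pos
  have hkR : (1 : ℝ) ≤ k := by exact_mod_cast hk
  set θ : ℝ := 1 / ((k : ℝ) + 1) with hθ
  have h0 : 0 < θ := by positivity
  have h1 : θ < 1 := by rw [hθ, div_lt_one (by positivity)]; linarith
  have e1 : ((2 * (k * (k + 1)) : ℕ) : ℝ) * θ = ((2 * k : ℕ) : ℝ) := by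
    rw [hθ]; push_cast; field_simp
  have e2 : ((2 * (k * (k + 1)) : ℕ) : ℝ) * (1 - θ) = ((k * (2 * k) : ℕ) : ℝ) := by
    rw [hθ]; push_cast; field_simp; ring
  have hstep : ∀ i, E (fun α : Fin k → ZMod Q => ‖f (cls p n (c + 1) (ζ i)) α‖ ^ (2 * k) *
      ‖f (cls p n b η) α‖ ^ (k * (2 * k))) ≤ C * (p : ℝ) ^ (n * lam - lam * (k / (k + 1)) * b) := by
    intro i
    have H := E_holder (F := fun α : Fin k → ZMod Q => ‖f (cls p n (c + 1) (ζ i)) α‖ ^ (2 * (k * (k + 1))))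
      (G := fun α : Fin k → ZMod Q => ‖f (cls p n b η) α‖ ^ (2 * (k * (k + 1))))
      (fun α => by positivity) (fun α => by positivity) h0 h1
    simp_rw [pow_rpow_eq (norm_nonneg _) _ _ _ e1, pow_rpow_eq (norm_nonneg _) _ _ _ e2] at H
    refine H.trans ?_
    have hA := h p hp1 Q n (c + 1) 0 hc (by omega) (ζ i) hQ
    have hB := h p hp1 Q n b b hb le_rfl η hQ
    calc _ ≤ (C * (p : ℝ) ^ (((n : ℝ) - (0 : ℕ)) * lam)) ^ θ *
          (C * (p : ℝ) ^ (((n : ℝ) - b) * lam)) ^ (1 - θ) := by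
          apply mul_le_mul
          · exact Real.rpow_le_rpow (E_nonneg fun α => by positivity) hA h0.le
          · exact Real.rpow_le_rpow (E_nonneg fun α => by positivity) hB (by linarith)
          · exact Real.rpow_nonneg (E_nonneg fun α => by positivity) _
          · positivity
      _ = _ := by
          rw [mulpow hC hC hpR, ← Real.rpow_add hC]
          have : θ + (1 - θ) = 1 := by ring
          rw [this, Real.rpow_one]
          congr 2
          rw [hθ]
          push_cast
          field_simp
          ring
  calc _ ≤ E (fun α : Fin k → ZMod Q => ∑ i, ‖f (cls p n (c + 1) (ζ i)) α‖ ^ (2 * k) *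
      ‖f (cls p n b η) α‖ ^ (k * (2 * k))) := by
        apply E_mono
        intro α
        rw [← Finset.sum_mul]
        gcongr
        have := prod_le_sum_pow hk (fun i => ‖f (cls p n (c + 1) (ζ i)) α‖ ^ 2)
          (fun i => by positivity)
        simpa only [← pow_mul] using this
    _ = ∑ i, E (fun α : Fin k → ZMod Q => ‖f (cls p n (c + 1) (ζ i)) α‖ ^ (2 * k) *
      ‖f (cls p n b η) α‖ ^ (k * (2 * k))) := E_sum _ _
    _ ≤ ∑ _i : Fin k, C * (p : ℝ) ^ (n * lam - lam * (k / (k + 1)) * b) :=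
        Finset.sum_le_sum fun i _ => hstep i
    _ = _ := by simp; ring

/-- broad/narrow step -/
lemma UB_step {k : ℕ} (hk : 1 ≤ k) (n c b : ℕ) (e : ℝ) (hU : UB k n c (b + 1) (e - 1))
    (hV : VB k n c b (e - (2 * k * k + k))) : UB k n c b e := by
  obtain ⟨C1, hC1, hU⟩ := hU
  obtain ⟨C2, hC2, hV⟩ := hV
  have hkR : (1 : ℝ) ≤ k := by exact_mod_cast hk
  refine ⟨(2 * k) ^ (k * (2 * k)) * C1 + 2 ^ (k * (2 * k)) * C2, by positivity,
    fun p hp hkp Q _ hQ ζ η hT => ?_⟩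
  have hpR : (0 : ℝ) < p := by exact_mod_cast hp.pos
  set Z := cls p (b + 1) b η with hZ
  have hcard : #Z ≤ p := by
    have := card_cls hp.pos (b + 1) b (by omega) η
    simpa using this
  have hcardR : (#Z : ℝ) ≤ p := by exact_mod_cast hcard
  set P : (Fin k → ZMod Q) → ℝ := fun α => ∏ i, ‖f (cls p n (c + 1) (ζ i)) α‖ ^ 2 with hP
  have hP0 : ∀ α, 0 ≤ P α := fun α => Finset.prod_nonneg fun i _ => by positivity
  set I := (Fintype.piFinset fun _ : Fin k => Z).filter Function.Injective with hI
  have hIcard : (#I : ℝ) ≤ (p : ℝ) ^ k := by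
    have : #I ≤ #Z ^ k := by
      refine (Finset.card_filter_le _ _).trans ?_
      simp
    calc (#I : ℝ) ≤ (#Z : ℝ) ^ k := by exact_mod_cast this
      _ ≤ _ := by gcongr
  have main : ∀ α : Fin k → ZMod Q, P α * ‖f (cls p n b η) α‖ ^ (k * (2 * k)) ≤
      (2 * k : ℝ) ^ (k * (2 * k)) * ∑ θ ∈ Z, P α * ‖f (cls p n (b + 1) θ) α‖ ^ (k * (2 * k)) +
      (2 * (p : ℝ)) ^ (k * (2 * k)) * ∑ u ∈ I, P α *
        ∏ i, ‖f (cls p n (b + 1) (u i)) α‖ ^ (2 * k) := by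
    intro α
    rw [← Finset.mul_sum, ← Finset.mul_sum]
    have hbn := broad_narrow Z (fun θ => ‖f (cls p n (b + 1) θ) α‖) (fun _ => norm_nonneg _)
      k (2 * k) hk (by omega)
    have h1 : ‖f (cls p n b η) α‖ ≤ ∑ θ ∈ Z, ‖f (cls p n (b + 1) θ) α‖ := by
      rw [f_split hp.pos n b (b + 1) (by omega) η α]
      exact norm_sum_le _ _
    calc P α * ‖f (cls p n b η) α‖ ^ (k * (2 * k))
        ≤ P α * (∑ θ ∈ Z, ‖f (cls p n (b + 1) θ) α‖) ^ (k * (2 * k)) := by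
          gcongr
      _ ≤ P α * ((2 * k : ℝ) ^ (k * (2 * k)) * ∑ θ ∈ Z, ‖f (cls p n (b + 1) θ) α‖ ^ (k * (2 * k)) +
          (2 * (p : ℝ)) ^ (k * (2 * k)) * ∑ u ∈ I, ∏ i, ‖f (cls p n (b + 1) (u i)) α‖ ^ (2 * k)) := by
          apply mul_le_mul_of_nonneg_left _ (hP0 α)
          refine hbn.trans ?_
          gcongr
      _ = _ := by ring
  have hsum1 : ∑ θ ∈ Z, E (fun α : Fin k → ZMod Q => P α *
      ‖f (cls p n (b + 1) θ) α‖ ^ (k * (2 * k))) ≤ p * (C1 * (p : ℝ) ^ (e - 1)) := by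
    calc _ ≤ ∑ θ ∈ Z, C1 * (p : ℝ) ^ (e - 1) :=
          Finset.sum_le_sum fun θ _ => hU p hp hkp Q hQ ζ θ hT
      _ = #Z * (C1 * (p : ℝ) ^ (e - 1)) := by simp
      _ ≤ _ := by gcongr
  have hsum2 : ∑ u ∈ I, E (fun α : Fin k → ZMod Q => P α *
      ∏ i, ‖f (cls p n (b + 1) (u i)) α‖ ^ (2 * k)) ≤
      (p : ℝ) ^ k * (C2 * (p : ℝ) ^ (e - (2 * k * k + k))) := by
    calc _ ≤ ∑ u ∈ I, C2 * (p : ℝ) ^ (e - (2 * k * k + k)) := by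
          apply Finset.sum_le_sum
          intro u hu
          rw [hI, Finset.mem_filter, Fintype.mem_piFinset] at hu
          exact hV p hp hkp Q hQ ζ η hT u hu.2 hu.1
      _ = #I * (C2 * (p : ℝ) ^ (e - (2 * k * k + k))) := by simp
      _ ≤ _ := by gcongr
  have e1 : (p : ℝ) * (C1 * (p : ℝ) ^ (e - 1)) = C1 * (p : ℝ) ^ e := by
    rw [Real.rpow_sub_one hpR.ne']
    field_simp
  have e2 : (p : ℝ) ^ (k * (2 * k)) * ((p : ℝ) ^ k * (C2 * (p : ℝ) ^ (e - (2 * k * k + k)))) =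
      C2 * (p : ℝ) ^ e := by
    rw [← Real.rpow_natCast, ← Real.rpow_natCast, mul_left_comm ((p : ℝ) ^ (k : ℝ)),
      mul_left_comm _ C2, ← Real.rpow_add hpR, ← Real.rpow_add hpR]
    congr 2
    push_cast
    ring
  calc _ ≤ _ := E_mono main
    _ = (2 * k : ℝ) ^ (k * (2 * k)) * ∑ θ ∈ Z, E (fun α : Fin k → ZMod Q => P α *
          ‖f (cls p n (b + 1) θ) α‖ ^ (k * (2 * k))) +
      (2 * (p : ℝ)) ^ (k * (2 * k)) * ∑ u ∈ I, E (fun α : Fin k → ZMod Q => P α *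
        ∏ i, ‖f (cls p n (b + 1) (u i)) α‖ ^ (2 * k)) := by
        rw [E_add, E_mul, E_mul, E_sum, E_sum]
    _ ≤ (2 * k : ℝ) ^ (k * (2 * k)) * (p * (C1 * (p : ℝ) ^ (e - 1))) +
      (2 * (p : ℝ)) ^ (k * (2 * k)) * ((p : ℝ) ^ k * (C2 * (p : ℝ) ^ (e - (2 * k * k + k)))) := by
        gcongr
    _ = _ := by
        rw [e1, mul_pow 2 (p : ℝ), mul_assoc ((2 : ℝ) ^ (k * (2 * k))), e2]
        ring

end VM

end VMV


namespace VMV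

open Finset

section VM2

lemma cast_tri (k : ℕ) : ((k * (k - 1) / 2 : ℕ) : ℝ) = (k : ℝ) * ((k : ℝ) - 1) / 2 := by
  rcases k with _ | k
  · simp
  · rw [Nat.cast_div (Nat.even_mul_pred_self (k + 1)).two_dvd (by norm_num)]
    push_cast
    simp

lemma VB_step {k : ℕ} (hk : 2 ≤ k) {lam : ℝ} (h : JB k lam) (hl : 0 ≤ lam) (n c b : ℕ)
    (hb1 : 1 ≤ b) (hcb : k * c ≤ b) (hbn : b + 1 ≤ n) (e' : ℝ) (hU : UB k n b (k * b) e') :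
    VB k n c b ((b + c) * (k * (k - 1) / 2) + k * (k * b - c) + (e' * (1 / k) +
      ((n : ℝ) - b) * lam * (1 - 1 / k))) := by
  obtain ⟨C1, hC1, h⟩ := J_cls_bound h hl
  obtain ⟨C2, hC2, hU⟩ := hU
  have hk1 : 1 ≤ k := by omega
  have hkR : (2 : ℝ) ≤ k := by exact_mod_cast hk
  set Cc : ℝ := C2 ^ (1 / (k : ℝ)) * (k * C1) ^ (1 - 1 / (k : ℝ)) with hCc
  have hCc0 : 0 < Cc := by positivity
  refine ⟨k * Cc, by positivity, fun p hp hkp Q _ hQ ζ η hT θ hθ1 hθ2 => ?_⟩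
  have hp1 : 1 ≤ p := hp.one_lt.le
  have hpR : (0 : ℝ) < p := by exact_mod_cast hp.pos
  have hpR1 : (1 : ℝ) ≤ p := by exact_mod_cast hp1
  have hccb : c ≤ b := le_trans (Nat.le_mul_of_pos_left c hk1) hcb
  have hbkb : 2 * b ≤ k * b := Nat.mul_le_mul_right b hk
  have hckb : c + 1 ≤ k * b := by omega
  have hQ' : (k + Fintype.card (Fin k × Fin k)) * (p ^ n) ^ k < Q := by
    simp only [Fintype.card_prod, Fintype.card_fin]
    convert hQ using 2
    ring
  have hcs := congr_step (Q := Q) hk1 hp hkp n b c hcb hckb ζ hT.1 hT.2 η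
    (ι := Fin k × Fin k) (fun l => cls p n (b + 1) (θ l.1)) (by
      intro l y hy
      rw [mem_cls] at hy
      exact ⟨hy.1, (hy.2.of_dvd (pow_dvd_pow _ (by omega))).trans (mem_cls.1 (hθ2 l.1)).2⟩) hQ'
  have hprod : ∀ α : Fin k → ZMod Q, ∏ l : Fin k × Fin k, ‖f (cls p n (b + 1) (θ l.1)) α‖ ^ 2 =
      ∏ i, ‖f (cls p n (b + 1) (θ i)) α‖ ^ (2 * k) := by
    intro α
    rw [Fintype.prod_prod_type]
    simp [← pow_mul]
  simp_rw [hprod] at hcs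
  refine hcs.trans ?_
  set W : (Fin k → ZMod Q) → ℝ := fun α => ∏ i, ‖f (cls p n (b + 1) (θ i)) α‖ with hW
  have hW0 : ∀ α, 0 ≤ W α := fun α => Finset.prod_nonneg fun i _ => norm_nonneg _
  have hTr : Tr p b θ := by
    refine ⟨fun i j => (mem_cls.1 (hθ2 i)).2.trans (mem_cls.1 (hθ2 j)).2.symm, ?_⟩
    intro i j hij hc
    exact hij (hθ1 (cls_eq_of_modEq (mem_cls.1 (hθ2 i)).1 (mem_cls.1 (hθ2 j)).1 hc))
  set T : ℝ := 1 / (k : ℝ) with hTdef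
  have hT0 : 0 < T := by positivity
  have hT1 : T < 1 := by rw [hTdef, div_lt_one (by positivity)]; linarith
  have hWE : E (fun α : Fin k → ZMod Q => W α ^ (2 * (k + 1))) ≤
      k * C1 * (p : ℝ) ^ (((n : ℝ) - b) * lam) := by
    calc _ ≤ E (fun α : Fin k → ZMod Q => ∑ i, ‖f (cls p n (b + 1) (θ i)) α‖ ^
            (2 * (k * (k + 1)))) := by
          apply E_mono
          intro α
          have := prod_le_sum_pow hk1 (fun i => ‖f (cls p n (b + 1) (θ i)) α‖ ^ (2 * (k + 1)))
            (fun i => by positivity)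
          rw [Finset.prod_pow] at this
          refine this.trans_eq ?_
          apply Finset.sum_congr rfl
          intro i _
          rw [← pow_mul]
          congr 1
          ring
      _ = ∑ i, E (fun α : Fin k → ZMod Q => ‖f (cls p n (b + 1) (θ i)) α‖ ^
            (2 * (k * (k + 1)))) := E_sum _ _
      _ ≤ ∑ _i : Fin k, C1 * (p : ℝ) ^ (((n : ℝ) - b) * lam) :=
          Finset.sum_le_sum fun i _ => h p hp1 Q n (b + 1) b hbn (by omega) (θ i) hQ
      _ = _ := by simp; ring
  have hone : ∀ ξ : ℤ, E (fun α : Fin k → ZMod Q => ‖f (cls p n (k * b) ξ) α‖ ^ (2 * k) *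
      W α ^ (2 * k)) ≤ Cc * (p : ℝ) ^ (e' * T + ((n : ℝ) - b) * lam * (1 - T)) := by
    intro ξ
    have H := E_holder (F := fun α : Fin k → ZMod Q => (‖f (cls p n (k * b) ξ) α‖ ^ (k * (2 * k)) *
      W α ^ 2)) (G := fun α : Fin k → ZMod Q => W α ^ (2 * (k + 1)))
      (fun α => by have := hW0 α; positivity) (fun α => by have := hW0 α; positivity) hT0 hT1
    have heq : ∀ α : Fin k → ZMod Q, (‖f (cls p n (k * b) ξ) α‖ ^ (k * (2 * k)) *
        W α ^ 2) ^ T * (W α ^ (2 * (k + 1))) ^ (1 - T) =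
        ‖f (cls p n (k * b) ξ) α‖ ^ (2 * k) * W α ^ (2 * k) := by
      intro α
      have hw := hW0 α
      rw [Real.mul_rpow (by positivity) (by positivity),
        pow_rpow_eq (norm_nonneg _) (k * (2 * k)) (2 * k) T (by
          rw [hTdef]; push_cast; field_simp), mul_assoc]
      congr 1
      rw [← Real.rpow_natCast_mul hw, ← Real.rpow_natCast_mul hw,
        ← Real.rpow_add_of_nonneg hw (by positivity)
          (mul_nonneg (by positivity) (by linarith)), ← Real.rpow_natCast]
      congr 1
      rw [hTdef]
      push_cast
      field_simp
      ring
    simp_rw [heq] at H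
    refine H.trans ?_
    have hA := hU p hp hkp Q hQ θ ξ hTr
    have hA' : E (fun α : Fin k → ZMod Q => (‖f (cls p n (k * b) ξ) α‖ ^ (k * (2 * k)) *
      W α ^ 2)) ≤ C2 * (p : ℝ) ^ e' := by
      refine le_trans (le_of_eq ?_) hA
      congr 1
      funext α
      rw [mul_comm, hW]
      simp only [Finset.prod_pow]
    calc _ ≤ (C2 * (p : ℝ) ^ e') ^ T * (k * C1 * (p : ℝ) ^ (((n : ℝ) - b) * lam)) ^ (1 - T) := by
          apply mul_le_mul
          · exact Real.rpow_le_rpow (E_nonneg fun α => by have := hW0 α; positivity) hA' hT0.le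
          · exact Real.rpow_le_rpow (E_nonneg fun α => by have := hW0 α; positivity) hWE
              (by linarith)
          · exact Real.rpow_nonneg (E_nonneg fun α => by have := hW0 α; positivity) _
          · positivity
      _ = _ := mulpow hC2 (by positivity) hpR
  have hall : ∀ θ' : Fin k → ℤ, E (fun α : Fin k → ZMod Q =>
      (∏ i, ‖f (cls p n (k * b) (θ' i)) α‖ ^ 2) * ∏ i, ‖f (cls p n (b + 1) (θ i)) α‖ ^ (2 * k)) ≤
      k * Cc * (p : ℝ) ^ (e' * T + ((n : ℝ) - b) * lam * (1 - T)) := by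
    intro θ'
    calc _ ≤ E (fun α : Fin k → ZMod Q => ∑ i, ‖f (cls p n (k * b) (θ' i)) α‖ ^ (2 * k) *
          W α ^ (2 * k)) := by
          apply E_mono
          intro α
          rw [← Finset.sum_mul, Finset.prod_pow (f := fun i => ‖f (cls p n (b + 1) (θ i)) α‖)]
          have hw := hW0 α
          apply mul_le_mul_of_nonneg_right _ (by positivity)
          have := prod_le_sum_pow hk1 (fun i => ‖f (cls p n (k * b) (θ' i)) α‖ ^ 2)
            (fun i => by positivity)
          simpa only [← pow_mul] using this
      _ = ∑ i, E (fun α : Fin k → ZMod Q => ‖f (cls p n (k * b) (θ' i)) α‖ ^ (2 * k) *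
          W α ^ (2 * k)) := E_sum _ _
      _ ≤ ∑ _i : Fin k, Cc * (p : ℝ) ^ (e' * T + ((n : ℝ) - b) * lam * (1 - T)) :=
          Finset.sum_le_sum fun i _ => hone _
      _ = _ := by simp; ring
  have hΘ : (#(Fintype.piFinset (fun i => cls p (k * b) (c + 1) (ζ i))) : ℝ) ≤
      (p : ℝ) ^ ((k : ℝ) * (k * b - c)) := by
    have h1 : #(Fintype.piFinset (fun i => cls p (k * b) (c + 1) (ζ i))) ≤
        (p ^ (k * b - c)) ^ k := by
      rw [Fintype.card_piFinset]
      calc _ ≤ ∏ _i : Fin k, p ^ (k * b - c) := by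
            apply Finset.prod_le_prod' 
            intro i _
            refine (card_cls hp.pos _ _ hckb _).trans ?_
            exact Nat.pow_le_pow_right hp.pos (by omega)
        _ = _ := by simp
    calc _ ≤ (((p ^ (k * b - c)) ^ k : ℕ) : ℝ) := by exact_mod_cast h1
      _ = _ := by
        push_cast
        rw [← pow_mul, ← Real.rpow_natCast]
        congr 1
        push_cast [Nat.cast_sub (show c ≤ k * b by omega)]
        ring
  calc _ ≤ (p : ℝ) ^ ((b + c) * (k * (k - 1) / 2)) *
        ∑ θ' ∈ Fintype.piFinset (fun i => cls p (k * b) (c + 1) (ζ i)),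
          k * Cc * (p : ℝ) ^ (e' * T + ((n : ℝ) - b) * lam * (1 - T)) := by
        gcongr with θ' _
        exact hall θ'
    _ = (p : ℝ) ^ ((b + c) * (k * (k - 1) / 2)) *
        (#(Fintype.piFinset (fun i => cls p (k * b) (c + 1) (ζ i))) *
          (k * Cc * (p : ℝ) ^ (e' * T + ((n : ℝ) - b) * lam * (1 - T)))) := by
        rw [Finset.sum_const, nsmul_eq_mul]
    _ ≤ (p : ℝ) ^ ((b + c) * (k * (k - 1) / 2)) * ((p : ℝ) ^ ((k : ℝ) * (k * b - c)) *
          (k * Cc * (p : ℝ) ^ (e' * T + ((n : ℝ) - b) * lam * (1 - T)))) := by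
        gcongr
    _ = _ := by
        have eM : (p : ℝ) ^ ((b + c) * (k * (k - 1) / 2) : ℕ) =
            (p : ℝ) ^ (((b : ℝ) + c) * ((k : ℝ) * (k - 1) / 2)) := by
          rw [← Real.rpow_natCast, Nat.cast_mul, cast_tri, Nat.cast_add]
        rw [eM, Real.rpow_add hpR (((b : ℝ) + c) * ((k : ℝ) * (k - 1) / 2) + k * (k * b - c)),
          Real.rpow_add hpR (((b : ℝ) + c) * ((k : ℝ) * (k - 1) / 2))]
        ring

end VM2

end VMV


namespace VMV

open Finset

section VM3

def SB (k : ℕ) (lam g : ℝ) (R : ℕ) : Prop :=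
  ∀ n b c : ℕ, k * c ≤ b → 1 ≤ b → R * b ≤ n →
    UB k n c b (n * lam - g * b + 2 * (2 * k * k + k))

lemma SB_start {k : ℕ} (hk : 3 ≤ k) {lam : ℝ} (h : JB k lam)
    (hl : 3 * k * (k + 1) / 2 ≤ lam) : SB k lam 2 2 := by
  intro n b c hcb hb hn
  have hkR : (3 : ℝ) ≤ k := by exact_mod_cast hk
  have hc : c ≤ b := le_trans (Nat.le_mul_of_pos_left c (by omega)) hcb
  have hl0 : 0 ≤ lam := le_trans (by positivity) hl
  apply UB_mono (UB_trivial (by omega) h hl0 n c b (by omega) (by omega))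
  have hb' : (1 : ℝ) ≤ b := by exact_mod_cast hb
  have h2 : 2 ≤ lam * ((k : ℝ) / (k + 1)) := by
    rw [mul_div_assoc', le_div_iff₀ (by positivity)]
    nlinarith
  nlinarith

lemma SB_step {k : ℕ} (hk : 3 ≤ k) {lam Δ g : ℝ} (h : JB k lam) (hΔ : 0 < Δ)
    (hl : 3 * k * (k + 1) / 2 + Δ ≤ lam) (hg : 1 ≤ g) {R : ℕ} (hR : 1 ≤ R) (hS : SB k lam g R) :
    SB k lam (g + (1 - 1 / k) * Δ) (k * R * (1 + ⌈g + (1 - 1 / k) * Δ⌉₊)) := by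
  intro n b c hcb hb hn
  have hkR : (3 : ℝ) ≤ k := by exact_mod_cast hk
  have hbR : (1 : ℝ) ≤ b := by exact_mod_cast hb
  have hl0 : 0 ≤ lam := le_trans (by positivity) hl
  set G := ⌈g + (1 - 1 / (k : ℝ)) * Δ⌉₊ with hG
  have hGle : g + (1 - 1 / (k : ℝ)) * Δ ≤ G := Nat.le_ceil _
  have hinv : 1 / (k : ℝ) ≤ 1 / 3 := one_div_le_one_div_of_le (by norm_num) hkR
  have hinv0 : 0 < 1 / (k : ℝ) := by positivity
  set δ := (1 - 1 / (k : ℝ)) * Δ with hδ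
  have hδ0 : 0 ≤ δ := mul_nonneg (by linarith) hΔ.le
  have h2 : 2 ≤ lam * ((k : ℝ) / (k + 1)) := by
    rw [mul_div_assoc', le_div_iff₀ (by positivity)]
    nlinarith
  set Dd : ℝ := 2 * k * k + k with hD
  have hD0 : 0 < Dd := by positivity
  set E0 : ℝ := n * lam - (g + δ) * b + 2 * Dd with hE0
  have hc : c ≤ b := le_trans (Nat.le_mul_of_pos_left c (by omega)) hcb
  have hbound : ∀ m : ℕ, m ≤ b * G → k * R * (b + m) ≤ n := by
    intro m hm
    refine le_trans ?_ hn
    have : b + m ≤ (1 + G) * b := by nlinarith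
    calc k * R * (b + m) ≤ k * R * ((1 + G) * b) := Nat.mul_le_mul_left _ this
      _ = _ := by ring
  have hkR3 : 3 ≤ k * R := by nlinarith
  -- downward induction
  have key : ∀ d m : ℕ, m + d = b * G → UB k n c (b + m) (E0 - m) := by
    intro d
    induction d with
    | zero =>
      intro m hm
      have hbm := hbound m (by omega)
      have hbm3 : 3 * (b + m) ≤ n := le_trans (Nat.mul_le_mul_right _ hkR3) hbm
      apply UB_mono (UB_trivial (by omega) h hl0 n c (b + m) (by omega) (by omega))
      have hmR : (m : ℝ) = b * G := by
        have : m = b * G := by omega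
        rw [this]; push_cast; rfl
      have hmG : (g + δ) * b ≤ m := by rw [hmR]; nlinarith
      have hm0 : (0 : ℝ) ≤ b + m := by positivity
      push_cast
      rw [hE0]
      nlinarith
    | succ d ih =>
      intro m hm
      have hbm := hbound m (by omega)
      have hbm3 : 3 * (b + m) ≤ n := le_trans (Nat.mul_le_mul_right _ hkR3) hbm
      apply UB_step (by omega) n c (b + m) (E0 - m)
      · have := ih (m + 1) (by omega)
        apply UB_mono this
        push_cast
        linarith
      · have hcb' : k * c ≤ b + m := by omega
        have hU := hS n (k * (b + m)) (b + m) le_rfl (Nat.mul_pos (by omega) (by omega))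
          (le_trans (le_of_eq (by ring)) hbm)
        have hV := VB_step (by omega) h hl0 n c (b + m) (by omega) hcb' (by omega) _ hU
        apply VB_mono hV
        push_cast
        set B : ℝ := (b : ℝ) + m with hB
        have hm0 : (0 : ℝ) ≤ m := by positivity
        have hcR : (k : ℝ) * c ≤ B := by rw [hB]; exact_mod_cast hcb'
        have hc0 : (0 : ℝ) ≤ c := by positivity
        have hB0 : 0 ≤ B := by positivity
        -- main exponent computation
        have e1 : (n * lam - g * (k * B) + 2 * (2 * k * k + k)) * (1 / (k : ℝ)) +
            ((n : ℝ) - B) * lam * (1 - 1 / k) =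
            n * lam - g * B + 2 * Dd * (1 / k) - B * (lam * (1 - 1 / k)) := by
          rw [hD]; field_simp; ring
        have e2 : 3 * ((k : ℝ) * k - 1) / 2 + δ ≤ lam * (1 - 1 / k) := by
          have : (3 * (k : ℝ) * (k + 1) / 2 + Δ) * (1 - 1 / k) = 3 * ((k : ℝ) * k - 1) / 2 + δ := by
            rw [hδ]; field_simp; ring
          rw [← this]
          apply mul_le_mul_of_nonneg_right hl (by linarith)
        have e3 : B * (3 * ((k : ℝ) * k - 1) / 2 + δ) ≤ B * (lam * (1 - 1 / k)) :=
          mul_le_mul_of_nonneg_left e2 hB0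
        have e4 : (k : ℝ) * c * (k - 3) ≤ B * (k - 3) :=
          mul_le_mul_of_nonneg_right hcR (by linarith)
        have e5 : 2 * Dd * (1 / k) ≤ 2 * Dd * (1 / 3) := by gcongr
        have e6 : 0 ≤ (g + δ - 1) * m := mul_nonneg (by linarith) hm0
        rw [e1, hE0]
        have hBm : (g + δ) * B = (g + δ) * b + (g + δ) * m := by rw [hB]; ring
        nlinarith
  have := key (b * G) 0 (by omega)
  simpa using this

lemma SB_exists {k : ℕ} (hk : 3 ≤ k) {Δ : ℝ} (hΔ : 0 < Δ) (m : ℕ) :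
    ∃ R : ℕ, 1 ≤ R ∧ ∀ lam : ℝ, 3 * k * (k + 1) / 2 + Δ ≤ lam → JB k lam →
      SB k lam (2 + m * ((1 - 1 / k) * Δ)) R := by
  have hkR : (3 : ℝ) ≤ k := by exact_mod_cast hk
  have hinv : 1 / (k : ℝ) ≤ 1 / 3 := one_div_le_one_div_of_le (by norm_num) hkR
  have hδ0 : 0 ≤ (1 - 1 / (k : ℝ)) * Δ := mul_nonneg (by linarith) hΔ.le
  induction m with
  | zero =>
    refine ⟨2, by norm_num, fun lam hl h => ?_⟩
    simpa using SB_start hk h (by linarith)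
  | succ m ih =>
    obtain ⟨R, hR, ih⟩ := ih
    refine ⟨k * R * (1 + ⌈2 + m * ((1 - 1 / k) * Δ) + (1 - 1 / (k : ℝ)) * Δ⌉₊), ?_, ?_⟩
    · apply Nat.mul_pos (Nat.mul_pos (by omega) hR) (by omega)
    · intro lam hl h
      have hg : 1 ≤ 2 + m * ((1 - 1 / (k : ℝ)) * Δ) := by
        have : 0 ≤ m * ((1 - 1 / (k : ℝ)) * Δ) := by positivity
        linarith
      have := SB_step hk h hΔ hl hg hR (ih lam hl h)
      convert this using 1
      push_cast
      ring

lemma J_le_E {k Q : ℕ} [NeZero Q] (t X : ℕ) :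
    (J k t X : ℝ) ≤ E (fun α : Fin k → ZMod Q => ‖f (Finset.Ico (0 : ℤ) X) α‖ ^ (2 * t)) := by
  have h : ∀ α : Fin k → ZMod Q, ‖f (Finset.Ico (0 : ℤ) X) α‖ ^ (2 * t) =
      ‖∑ x ∈ Fintype.piFinset (fun _ : Fin t => Finset.Ico (0 : ℤ) X),
        ch α (∑ i, mom k (x i))‖ ^ 2 := by
    intro α
    rw [mul_comm 2 t, pow_mul, ← norm_pow]
    congr 2
    rw [← prod_f]
    simp
  simp_rw [h]
  rw [E_sq]
  apply Nat.cast_le.2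
  unfold J
  apply Finset.card_le_card
  intro q hq
  unfold sols at hq
  rw [Finset.mem_filter] at hq ⊢
  refine ⟨hq.1, fun j => ?_⟩
  rw [mom_sum, mom_sum, hq.2 j]

lemma J_mono {k t X Y : ℕ} (h : X ≤ Y) : J k t X ≤ J k t Y := by
  unfold J sols
  apply Finset.card_le_card
  apply Finset.filter_subset_filter
  have hs : Finset.Ico (0 : ℤ) X ⊆ Finset.Ico (0 : ℤ) Y := by
    apply Finset.Ico_subset_Ico le_rfl
    exact_mod_cast h
  exact Finset.product_subset_product (Fintype.piFinset_subset _ _ fun _ => hs)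
    (Fintype.piFinset_subset _ _ fun _ => hs)

lemma JB_trivial (k : ℕ) : JB k ((2 * (k * (k + 1)) : ℕ) : ℝ) := by
  refine ⟨1, one_pos, fun X hX => ?_⟩
  rw [Real.rpow_natCast, one_mul]
  have : J k (k * (k + 1)) X ≤ X ^ (2 * (k * (k + 1))) := by
    unfold J sols
    refine (Finset.card_filter_le _ _).trans ?_
    rw [Finset.card_product, Fintype.card_piFinset]
    simp
    rw [← pow_add, two_mul]
  exact_mod_cast this

lemma JB_mono {k : ℕ} {l l' : ℝ} (h : JB k l) (hl : l ≤ l') : JB k l' := by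
  obtain ⟨C, hC, h⟩ := h
  refine ⟨C, hC, fun X hX => (h X hX).trans ?_⟩
  have : (1 : ℝ) ≤ X := by exact_mod_cast hX
  gcongr

end VM3

end VMV


namespace VMV

open Finset

section VM4

lemma J_prime {k : ℕ} (hk : 3 ≤ k) {lam : ℝ} (h : JB k lam) (hl : 2 ≤ lam) (n : ℕ) (hn : 1 ≤ n)
    (g : ℝ) (hg : 2 * (k * (k + 1)) + k + 1 ≤ g) (hU : UB k n 0 1 (n * lam - g)) :
    ∃ C : ℝ, 0 < C ∧ ∀ p : ℕ, p.Prime → k < p →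
      (J k (k * (k + 1)) (p ^ n) : ℝ) ≤ C * (p : ℝ) ^ (n * lam - 1) := by
  obtain ⟨C1, hC1, h⟩ := J_cls_bound h (by linarith)
  obtain ⟨C2, hC2, hU⟩ := hU
  have hk1 : 1 ≤ k := by omega
  have hkR : (3 : ℝ) ≤ k := by exact_mod_cast hk
  refine ⟨(2 * k) ^ (k * (2 * (k + 1))) * C1 + 2 ^ (k * (2 * (k + 1))) * (k * C2),
    by positivity, fun p hp hkp => ?_⟩
  have hp1 : 1 ≤ p := hp.one_lt.le
  have hpR : (0 : ℝ) < p := by exact_mod_cast hp.pos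
  have hpR1 : (1 : ℝ) ≤ p := by exact_mod_cast hp1
  set Q := k * (k + 1) * (p ^ n) ^ k + 1 with hQd
  have hQ : k * (k + 1) * (p ^ n) ^ k < Q := by omega
  have : NeZero Q := ⟨by omega⟩
  refine (J_le_E (Q := Q) _ _).trans ?_
  have hI0 : (Finset.Ico (0 : ℤ) ((p ^ n : ℕ) : ℤ)) = cls p n 0 0 := by
    ext x
    rw [mem_cls, Finset.mem_Ico]
    push_cast
    simp [Int.modEq_one]
  rw [hI0]
  set Z := cls p 1 0 0 with hZ
  have hcard : #Z ≤ p := by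
    have := card_cls hp.pos 1 0 (by omega) 0
    simpa using this
  have hcardR : (#Z : ℝ) ≤ p := by exact_mod_cast hcard
  set I := (Fintype.piFinset fun _ : Fin k => Z).filter Function.Injective with hI
  have hIcard : (#I : ℝ) ≤ (p : ℝ) ^ k := by
    have : #I ≤ #Z ^ k := by
      refine (Finset.card_filter_le _ _).trans ?_
      simp
    calc (#I : ℝ) ≤ (#Z : ℝ) ^ k := by exact_mod_cast this
      _ ≤ _ := by gcongr
  have main : ∀ α : Fin k → ZMod Q, ‖f (cls p n 0 0) α‖ ^ (2 * (k * (k + 1))) ≤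
      (2 * k : ℝ) ^ (k * (2 * (k + 1))) * ∑ θ ∈ Z, ‖f (cls p n 1 θ) α‖ ^ (2 * (k * (k + 1))) +
      (2 * (p : ℝ)) ^ (k * (2 * (k + 1))) * ∑ u ∈ I, ∑ l,
        (∏ i, ‖f (cls p n (0 + 1) (u i)) α‖ ^ 2) * ‖f (cls p n 1 (u l)) α‖ ^ (k * (2 * k)) := by
    intro α
    have hbn := broad_narrow Z (fun θ => ‖f (cls p n 1 θ) α‖) (fun _ => norm_nonneg _)
      k (2 * (k + 1)) hk1 (by omega)
    have h1 : ‖f (cls p n 0 0) α‖ ≤ ∑ θ ∈ Z, ‖f (cls p n 1 θ) α‖ := by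
      rw [f_split hp.pos n 0 1 (by omega) 0 α]
      exact norm_sum_le _ _
    have he : 2 * (k * (k + 1)) = k * (2 * (k + 1)) := by ring
    calc ‖f (cls p n 0 0) α‖ ^ (2 * (k * (k + 1)))
        ≤ (∑ θ ∈ Z, ‖f (cls p n 1 θ) α‖) ^ (k * (2 * (k + 1))) := by
          rw [he]; gcongr
      _ ≤ _ := by
          refine hbn.trans ?_
          rw [he]
          have hu : ∀ u : Fin k → ℤ, ∏ i, ‖f (cls p n 1 (u i)) α‖ ^ (2 * (k + 1)) ≤
              ∑ l, (∏ i, ‖f (cls p n (0 + 1) (u i)) α‖ ^ 2) *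
                ‖f (cls p n 1 (u l)) α‖ ^ (k * (2 * k)) := by
            intro u
            rw [← Finset.mul_sum]
            have e1 : ∏ i, ‖f (cls p n 1 (u i)) α‖ ^ (2 * (k + 1)) =
                (∏ i, ‖f (cls p n (0 + 1) (u i)) α‖ ^ 2) *
                  ∏ i, ‖f (cls p n 1 (u i)) α‖ ^ (2 * k) := by
              rw [← Finset.prod_mul_distrib]
              apply Finset.prod_congr rfl
              intro i _
              rw [zero_add, ← pow_add]
              congr 1
              ring
            rw [e1]
            apply mul_le_mul_of_nonneg_left _ (Finset.prod_nonneg fun i _ => by positivity)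
            have := prod_le_sum_pow hk1 (fun i => ‖f (cls p n 1 (u i)) α‖ ^ (2 * k))
              (fun i => by positivity)
            refine this.trans_eq ?_
            apply Finset.sum_congr rfl
            intro i _
            rw [← pow_mul]
            congr 1
            ring
          gcongr with u _
          exact hu u
  have hsum1 : ∑ θ ∈ Z, E (fun α : Fin k → ZMod Q =>
      ‖f (cls p n 1 θ) α‖ ^ (2 * (k * (k + 1)))) ≤ C1 * (p : ℝ) ^ (n * lam - 1) := by
    calc _ ≤ ∑ θ ∈ Z, C1 * (p : ℝ) ^ (((n : ℝ) - (1 : ℕ)) * lam) :=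
          Finset.sum_le_sum fun θ _ => h p hp1 Q n 1 1 hn le_rfl θ hQ
      _ = #Z * (C1 * (p : ℝ) ^ (((n : ℝ) - (1 : ℕ)) * lam)) := by simp
      _ ≤ p * (C1 * (p : ℝ) ^ (n * lam - 2)) := by
          gcongr
          push_cast
          nlinarith
      _ = _ := by
          have : (n : ℝ) * lam - 1 = (n * lam - 2) + 1 := by ring
          rw [this, Real.rpow_add_one hpR.ne']
          ring
  have hsum2 : ∑ u ∈ I, ∑ l, E (fun α : Fin k → ZMod Q =>
      (∏ i, ‖f (cls p n (0 + 1) (u i)) α‖ ^ 2) * ‖f (cls p n 1 (u l)) α‖ ^ (k * (2 * k))) ≤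
      (p : ℝ) ^ k * (k * (C2 * (p : ℝ) ^ (n * lam - g))) := by
    calc _ ≤ ∑ u ∈ I, ∑ _l : Fin k, C2 * (p : ℝ) ^ (n * lam - g) := by
          apply Finset.sum_le_sum
          intro u hu
          apply Finset.sum_le_sum
          intro l _
          rw [hI, Finset.mem_filter, Fintype.mem_piFinset] at hu
          apply hU p hp hkp Q hQ u (u l)
          refine ⟨fun i j => by simp [Int.modEq_one], ?_⟩
          intro i j hij hc
          exact hij (hu.2 (cls_eq_of_modEq (mem_cls.1 (hu.1 i)).1 (mem_cls.1 (hu.1 j)).1 hc))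
      _ = #I * (k * (C2 * (p : ℝ) ^ (n * lam - g))) := by simp
      _ ≤ _ := by gcongr
  have e2 : (p : ℝ) ^ (k * (2 * (k + 1))) * ((p : ℝ) ^ k * (k * (C2 * (p : ℝ) ^ (n * lam - g)))) ≤
      k * C2 * (p : ℝ) ^ (n * lam - 1) := by
    have : (p : ℝ) ^ (k * (2 * (k + 1))) * ((p : ℝ) ^ k * (k * (C2 * (p : ℝ) ^ (n * lam - g)))) =
        k * C2 * (p : ℝ) ^ ((2 * (k * (k + 1)) + k : ℝ) + (n * lam - g)) := by
      rw [Real.rpow_add hpR, Real.rpow_add hpR, Real.rpow_natCast]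
      have : (p : ℝ) ^ (k * (2 * (k + 1))) = (p : ℝ) ^ (2 * ((k : ℝ) * (k + 1))) := by
        rw [← Real.rpow_natCast]
        congr 1
        push_cast
        ring
      rw [this]
      ring
    rw [this]
    gcongr
    linarith
  calc _ ≤ _ := E_mono main
    _ = (2 * k : ℝ) ^ (k * (2 * (k + 1))) * ∑ θ ∈ Z, E (fun α : Fin k → ZMod Q =>
          ‖f (cls p n 1 θ) α‖ ^ (2 * (k * (k + 1)))) +
      (2 * (p : ℝ)) ^ (k * (2 * (k + 1))) * ∑ u ∈ I, ∑ l, E (fun α : Fin k → ZMod Q =>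
        (∏ i, ‖f (cls p n (0 + 1) (u i)) α‖ ^ 2) * ‖f (cls p n 1 (u l)) α‖ ^ (k * (2 * k))) := by
        rw [E_add, E_mul, E_mul, E_sum, E_sum]
        simp_rw [E_sum]
    _ ≤ (2 * k : ℝ) ^ (k * (2 * (k + 1))) * (C1 * (p : ℝ) ^ (n * lam - 1)) +
      (2 * (p : ℝ)) ^ (k * (2 * (k + 1))) *
        ((p : ℝ) ^ k * (k * (C2 * (p : ℝ) ^ (n * lam - g)))) := by
        gcongr
    _ ≤ _ := by
        rw [mul_pow 2 (p : ℝ), mul_assoc ((2 : ℝ) ^ (k * (2 * (k + 1))))]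
        have := mul_le_mul_of_nonneg_left e2 (show (0 : ℝ) ≤ 2 ^ (k * (2 * (k + 1))) by positivity)
        linarith

lemma JB_of_prime {k : ℕ} {lam : ℝ} (n : ℕ) (hn : 1 ≤ n) (hl : 1 ≤ lam)
    (h : ∃ C : ℝ, 0 < C ∧ ∀ p : ℕ, p.Prime → k < p →
      (J k (k * (k + 1)) (p ^ n) : ℝ) ≤ C * (p : ℝ) ^ (n * lam - 1)) : JB k (lam - 1 / n) := by
  obtain ⟨C, hC, h⟩ := h
  have hnR : (1 : ℝ) ≤ n := by exact_mod_cast hn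
  have he : 0 ≤ n * lam - 1 := by nlinarith
  refine ⟨C * (2 * (k + 2)) ^ (n * lam - 1), by positivity, fun X hX => ?_⟩
  have hXR : (1 : ℝ) ≤ X := by exact_mod_cast hX
  set y : ℝ := (X : ℝ) ^ (1 / (n : ℝ)) with hy
  have hy1 : 1 ≤ y := Real.one_le_rpow hXR (by positivity)
  have hyn : y ^ n = X := by
    rw [hy, ← Real.rpow_mul_natCast (by linarith)]
    rw [one_div_mul_cancel (by positivity), Real.rpow_one]
  set m := ⌈y⌉₊ + k with hm
  have hm0 : m ≠ 0 := by
    have : 0 < ⌈y⌉₊ := Nat.ceil_pos.2 (by linarith)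
    omega
  obtain ⟨p, hp, hmp, hp2⟩ := Nat.exists_prime_lt_and_le_two_mul m hm0
  have hyp : y ≤ p := (Nat.le_ceil y).trans (by exact_mod_cast (by omega))
  have hXp : X ≤ p ^ n := by
    have : (X : ℝ) ≤ (p : ℝ) ^ n := by
      rw [← hyn]; gcongr
    exact_mod_cast this
  have hpy : (p : ℝ) ≤ 2 * (k + 2) * y := by
    have h1 : (p : ℝ) ≤ 2 * m := by exact_mod_cast hp2
    have h2 : (m : ℝ) ≤ y + 1 + k := by
      rw [hm]; push_cast
      have := Nat.ceil_lt_add_one (show 0 ≤ y by linarith)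
      linarith
    have hk0 : (0 : ℝ) ≤ k := by positivity
    nlinarith
  calc (J k (k * (k + 1)) X : ℝ) ≤ J k (k * (k + 1)) (p ^ n) := by exact_mod_cast J_mono hXp
    _ ≤ C * (p : ℝ) ^ (n * lam - 1) := h p hp (by omega)
    _ ≤ C * (2 * (k + 2) * y) ^ (n * lam - 1) := by gcongr
    _ = _ := by
        rw [Real.mul_rpow (by positivity) (by linarith), ← mul_assoc, hy,
          ← Real.rpow_mul (by linarith)]
        congr 2
        field_simp

lemma JB_improve {k : ℕ} (hk : 3 ≤ k) {Δ : ℝ} (hΔ : 0 < Δ) :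
    ∃ n : ℕ, 1 ≤ n ∧ ∀ lam : ℝ, 3 * k * (k + 1) / 2 + Δ ≤ lam → JB k lam →
      JB k (lam - 1 / n) := by
  have hkR : (3 : ℝ) ≤ k := by exact_mod_cast hk
  have hinv : 1 / (k : ℝ) ≤ 1 / 3 := one_div_le_one_div_of_le (by norm_num) hkR
  have hδ0 : 0 < (1 - 1 / (k : ℝ)) * Δ := mul_pos (by linarith) hΔ
  obtain ⟨m, hm⟩ := exists_nat_ge
    ((2 * (k * (k + 1)) + k + 1 + 2 * (2 * k * k + k)) / ((1 - 1 / (k : ℝ)) * Δ))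
  rw [div_le_iff₀ hδ0] at hm
  obtain ⟨R, hR, hS⟩ := SB_exists hk hΔ m
  refine ⟨R, hR, fun lam hl h => ?_⟩
  have hl2 : 2 ≤ lam := by nlinarith
  apply JB_of_prime R hR (by linarith)
  have hU := hS lam hl h R 1 0 (by omega) le_rfl (by omega)
  apply J_prime hk h hl2 R hR (2 + m * ((1 - 1 / k) * Δ) - 2 * (2 * k * k + k)) (by linarith)
  convert hU using 1
  push_cast
  ring

/-- near-optimal Vinogradov mean value bound for `t = k(k+1)` -/
theorem vmvt {k : ℕ} (hk : 3 ≤ k) {Δ : ℝ} (hΔ : 0 < Δ) : JB k (3 * k * (k + 1) / 2 + Δ) := by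
  obtain ⟨n, hn, h⟩ := JB_improve hk hΔ
  have hnR : (0 : ℝ) < n := by exact_mod_cast hn
  have key : ∀ m : ℕ, JB k (max (3 * k * (k + 1) / 2 + Δ)
      (((2 * (k * (k + 1)) : ℕ) : ℝ) - m * (1 / n))) := by
    intro m
    induction m with
    | zero => 
      apply JB_mono (JB_trivial k)
      simp
    | succ m ih =>
      by_cases hc : ((2 * (k * (k + 1)) : ℕ) : ℝ) - m * (1 / n) ≤ 3 * k * (k + 1) / 2 + Δ
      · rw [max_eq_left hc] at ih
        exact JB_mono ih (le_max_left _ _)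
      · rw [max_eq_right (not_le.1 hc).le] at ih
        apply JB_mono (h _ (not_le.1 hc).le ih)
        apply le_max_of_le_right
        push_cast
        linarith
  obtain ⟨m, hm⟩ := exists_nat_ge (((2 * (k * (k + 1)) : ℕ) : ℝ) * n)
  have := key m
  rwa [max_eq_left] at this
  have h1 : ((2 * (k * (k + 1)) : ℕ) : ℝ) ≤ m * (1 / n) := by
    rw [mul_one_div, le_div_iff₀ hnR]; exact hm
  have : (0 : ℝ) ≤ 3 * k * (k + 1) / 2 + Δ := by positivity
  linarith

end VM4

end VMV


namespace VMV

open Finset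

section Four

noncomputable def ee (x : ℝ) : ℂ := Complex.exp (Complex.I * ((2 * Real.pi * x : ℝ) : ℂ))

lemma ee_add (x y : ℝ) : ee (x + y) = ee x * ee y := by
  unfold ee
  rw [← Complex.exp_add]
  congr 1
  push_cast
  ring

lemma ee_norm (x : ℝ) : ‖ee x‖ = 1 := by
  unfold ee
  rw [mul_comm]
  exact Complex.norm_exp_ofReal_mul_I _

lemma ee_zero : ee 0 = 1 := by simp [ee]

lemma ee_int (n : ℤ) : ee n = 1 := by
  unfold ee
  rw [Complex.exp_eq_one_iff]
  exact ⟨n, by push_cast; ring⟩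

lemma ee_sum {ι : Type*} (s : Finset ι) (x : ι → ℝ) : ee (∑ i ∈ s, x i) = ∏ i ∈ s, ee (x i) := by
  classical
  induction s using Finset.induction_on with
  | empty => simp [ee_zero]
  | insert a s has ih => rw [Finset.sum_insert has, Finset.prod_insert has, ee_add, ih]

lemma ee_conj (x : ℝ) : (starRingEnd ℂ) (ee x) = ee (-x) := by
  unfold ee
  rw [← Complex.exp_conj]
  congr 1
  rw [map_mul, Complex.conj_I, Complex.conj_ofReal]
  push_cast
  ring

lemma ee_nat_mul (n : ℕ) (x : ℝ) : ee (n * x) = ee x ^ n := by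
  induction n with
  | zero => simp [ee_zero]
  | succ n ih => rw [pow_succ, ← ih, ← ee_add]; congr 1; push_cast; ring

lemma ee_sub_le (x y : ℝ) : ‖ee x - ee y‖ ≤ 2 * Real.pi * |x - y| := by
  have h1 : ee x - ee y = ee y * (ee (x - y) - 1) := by
    rw [mul_sub, ← ee_add]
    congr 2 <;> ring_nf
  rw [h1, norm_mul, ee_norm, one_mul]
  unfold ee
  refine (Real.norm_exp_I_mul_ofReal_sub_one_le).trans_eq ?_
  rw [Real.norm_eq_abs, abs_mul, abs_of_pos (by positivity)]

lemma ee_sub_one_ge (x : ℝ) : 4 * |x - round x| ≤ ‖ee x - 1‖ := by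
  have h0 : ee x = ee (x - round x) := by
    have : x = (x - round x) + ((round x : ℤ) : ℝ) := by ring
    conv_lhs => rw [this]
    rw [ee_add, ee_int, mul_one]
  rw [h0]
  have h2 := abs_sub_round x
  set z := x - round x
  unfold ee
  rw [Complex.norm_exp_I_mul_ofReal_sub_one, Real.norm_eq_abs, abs_mul]
  have hpi := Real.pi_pos
  have h3 := Real.mul_abs_le_abs_sin (x := 2 * Real.pi * z / 2) (by
    have e : 2 * Real.pi * z / 2 = Real.pi * z := by ring
    rw [e, abs_mul, abs_of_pos hpi]
    nlinarith)
  have h4 : 2 / Real.pi * |2 * Real.pi * z / 2| = 2 * |z| := by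
    have e : 2 * Real.pi * z / 2 = Real.pi * z := by ring
    rw [e, abs_mul, abs_of_pos hpi]
    field_simp
  rw [h4] at h3
  rw [abs_of_pos (by norm_num : (0 : ℝ) < 2)]
  linarith

lemma geom_bound (H : ℕ) (x δ : ℝ) (hδ : 0 < δ) (hx : δ ≤ |x - round x|) :
    ‖∑ h ∈ range H, ee (h * x)‖ ≤ 1 / (2 * δ) := by
  have h1 := ee_sub_one_ge x
  have hpos : 0 < ‖ee x - 1‖ := by linarith
  have hne : ee x ≠ 1 := by
    intro h
    rw [h] at hpos
    simp at hpos
  simp_rw [ee_nat_mul]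
  rw [geom_sum_eq hne, norm_div]
  have h2 : ‖ee x ^ H - 1‖ ≤ 2 := by
    refine (norm_sub_le _ _).trans ?_
    rw [norm_pow, ee_norm]
    norm_num
  rw [div_le_div_iff₀ hpos (by positivity)]
  nlinarith

/-- from no small fractional part to a large exponential sum -/
lemma large_sum {ι : Type*} (A : Finset ι) (θ : ι → ℝ) (δ : ℝ) (hδ : 0 < δ)
    (hθ : ∀ n ∈ A, δ ≤ |θ n - round (θ n)|) (H r : ℕ) (hH : 1 ≤ H) (hr : 1 ≤ r)
    (hcond : 2 * r * H * (1 / (2 * δ)) ^ (2 * r) ≤ (H : ℝ) ^ (2 * r)) :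
    ∃ h : ℕ, 1 ≤ h ∧ h ≤ r * H ∧ (#A : ℝ) / (2 * r * H) ≤ ‖∑ n ∈ A, ee (h * θ n)‖ := by
  by_contra hcon
  push Not at hcon
  have hHR : (1 : ℝ) ≤ H := by exact_mod_cast hH
  have hrR : (1 : ℝ) ≤ r := by exact_mod_cast hr
  set P : ℝ := (#A : ℝ) / (2 * r * H) with hP
  set V := Fintype.piFinset (fun _ : Fin r => range H) with hV
  set s : (Fin r → ℕ) → ℕ := fun v => ∑ i, v i with hs
  have hsV : ∀ v ∈ V, s v < r * H := by
    intro v hv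
    rw [hV, Fintype.mem_piFinset] at hv
    calc s v < ∑ _i : Fin r, H := by
          apply Finset.sum_lt_sum_of_nonempty ⟨⟨0, hr⟩, Finset.mem_univ _⟩
          intro i _
          exact Finset.mem_range.1 (hv i)
      _ = r * H := by simp
  have hVcard : #V = H ^ r := by rw [hV, Fintype.card_piFinset]; simp
  have hexp : ∀ x : ℝ, ((‖∑ h ∈ range H, ee (h * x)‖ ^ (2 * r) : ℝ) : ℂ) =
      ∑ q ∈ V ×ˢ V, ee (((s q.1 : ℝ) - s q.2) * x) := by
    intro x
    have h1 : (∑ h ∈ range H, ee (h * x)) ^ r = ∑ v ∈ V, ee (s v * x) := by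
      have : (∑ h ∈ range H, ee (h * x)) ^ r = ∏ _i : Fin r, ∑ h ∈ range H, ee (h * x) := by simp
      rw [this, Finset.prod_univ_sum]
      apply Finset.sum_congr rfl
      intro v _
      rw [← ee_sum]
      congr 1
      rw [hs]
      push_cast
      rw [Finset.sum_mul]
    rw [mul_comm 2 r, pow_mul, ← norm_pow, h1]
    push_cast
    rw [← Complex.mul_conj', map_sum, Finset.sum_mul_sum, Finset.sum_product]
    apply Finset.sum_congr rfl
    intro v _
    apply Finset.sum_congr rfl
    intro w _
    rw [ee_conj, ← ee_add]
    congr 1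
    ring
  have hS : ∀ q ∈ V ×ˢ V, s q.1 ≠ s q.2 → ‖∑ n ∈ A, ee (((s q.1 : ℝ) - s q.2) * θ n)‖ ≤ P := by
    intro q hq hne
    rw [Finset.mem_product] at hq
    have b1 := hsV _ hq.1
    have b2 := hsV _ hq.2
    rcases Nat.lt_or_gt_of_ne hne with hlt | hlt
    · have h2 := hcon (s q.2 - s q.1) (by omega) (by omega)
      have h3 : ∑ n ∈ A, ee (((s q.1 : ℝ) - s q.2) * θ n) =
          (starRingEnd ℂ) (∑ n ∈ A, ee (((s q.2 - s q.1 : ℕ) : ℝ) * θ n)) := by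
        rw [map_sum]
        apply Finset.sum_congr rfl
        intro n _
        rw [ee_conj, Nat.cast_sub hlt.le]
        congr 1
        ring
      rw [h3, RCLike.norm_conj]
      exact h2.le
    · have h2 := hcon (s q.1 - s q.2) (by omega) (by omega)
      rw [Nat.cast_sub hlt.le] at h2
      exact h2.le
  have htot : ((∑ n ∈ A, ‖∑ h ∈ range H, ee (h * θ n)‖ ^ (2 * r) : ℝ) : ℂ) =
      (#{q ∈ V ×ˢ V | s q.1 = s q.2} : ℂ) * #A +
        ∑ q ∈ V ×ˢ V with ¬ s q.1 = s q.2, ∑ n ∈ A, ee (((s q.1 : ℝ) - s q.2) * θ n) := by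
    push_cast
    have := fun n => hexp (θ n)
    push_cast at this
    simp_rw [this]
    rw [Finset.sum_comm, ← Finset.sum_filter_add_sum_filter_not (V ×ˢ V) (fun q => s q.1 = s q.2)]
    congr 1
    rw [Finset.sum_congr rfl (g := fun _ => (#A : ℂ))]
    · simp
    · intro q hq
      rw [Finset.mem_filter] at hq
      rw [hq.2]
      simp [ee_zero]
  have hPpos : 0 < P := by
    have := hcon 1 le_rfl (by nlinarith)
    exact lt_of_le_of_lt (norm_nonneg _) this
  have hcardVV : ((#{q ∈ V ×ˢ V | s q.1 = s q.2} : ℕ) : ℝ) +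
      (#{q ∈ V ×ˢ V | ¬ s q.1 = s q.2} : ℕ) = (H : ℝ) ^ (2 * r) := by
    have := Finset.card_filter_add_card_filter_not (s := V ×ˢ V) (fun q => s q.1 = s q.2)
    rw [Finset.card_product, hVcard, ← pow_add, ← two_mul] at this
    exact_mod_cast this
  have hdiag : (H : ℝ) ^ (2 * r) ≤ r * H * (#{q ∈ V ×ˢ V | s q.1 = s q.2} : ℕ) := by
    have h1 : #V = ∑ c ∈ range (r * H), #{v ∈ V | s v = c} :=
      Finset.card_eq_sum_card_fiberwise (fun v hv => Finset.mem_coe.2 (Finset.mem_range.2 (hsV v hv)))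
    have h2 : #{q ∈ V ×ˢ V | s q.1 = s q.2} = ∑ c ∈ range (r * H), #{v ∈ V | s v = c} ^ 2 := by
      rw [Finset.card_eq_sum_card_fiberwise (f := fun q => s q.1) (t := range (r * H))]
      · apply Finset.sum_congr rfl
        intro c _
        rw [sq, ← Finset.card_product]
        congr 1
        ext q
        simp only [Finset.mem_filter, Finset.mem_product]
        constructor
        · rintro ⟨⟨⟨a, b⟩, c⟩, d⟩
          exact ⟨⟨a, d⟩, b, by rw [← c, d]⟩
        · rintro ⟨⟨a, b⟩, c, d⟩
          exact ⟨⟨⟨a, c⟩, by rw [b, d]⟩, b⟩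
      · intro q hq
        rw [Finset.mem_coe, Finset.mem_filter, Finset.mem_product] at hq
        exact Finset.mem_coe.2 (Finset.mem_range.2 (hsV _ hq.1.1))
    have h3 : (#V) ^ 2 ≤ #(range (r * H)) * ∑ c ∈ range (r * H), #{v ∈ V | s v = c} ^ 2 := by
      rw [h1]
      exact sq_sum_le_card_mul_sum_sq
    rw [← h2, hVcard, Finset.card_range, ← pow_mul, mul_comm r 2] at h3
    exact_mod_cast h3
  set dg : ℝ := ((#{q ∈ V ×ˢ V | s q.1 = s q.2} : ℕ) : ℝ) with hdg
  have hHpow : 0 < (H : ℝ) ^ (2 * r) := by positivity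
  have hdgpos : 0 < dg := by
    by_contra h
    push Not at h
    have : (r : ℝ) * H * dg ≤ 0 := mul_nonpos_of_nonneg_of_nonpos (by positivity) h
    linarith
  have hoff : ‖∑ q ∈ V ×ˢ V with ¬ s q.1 = s q.2, ∑ n ∈ A, ee (((s q.1 : ℝ) - s q.2) * θ n)‖ <
      (H : ℝ) ^ (2 * r) * P := by
    have h1 : ‖∑ q ∈ V ×ˢ V with ¬ s q.1 = s q.2, ∑ n ∈ A, ee (((s q.1 : ℝ) - s q.2) * θ n)‖ ≤
        ∑ q ∈ V ×ˢ V with ¬ s q.1 = s q.2, P := by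
      apply norm_sum_le_of_le
      intro q hq
      rw [Finset.mem_filter] at hq
      exact hS q hq.1 hq.2
    rw [Finset.sum_const, nsmul_eq_mul] at h1
    refine lt_of_le_of_lt h1 ?_
    have : ((#{q ∈ V ×ˢ V | ¬ s q.1 = s q.2} : ℕ) : ℝ) < (H : ℝ) ^ (2 * r) := by linarith
    exact mul_lt_mul_of_pos_right this hPpos
  have htot2 : ∑ n ∈ A, ‖∑ h ∈ range H, ee (h * θ n)‖ ^ (2 * r) ≤ #A * (1 / (2 * δ)) ^ (2 * r) := by
    rw [← nsmul_eq_mul]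
    apply Finset.sum_le_card_nsmul
    intro n hn
    exact pow_le_pow_left₀ (norm_nonneg _) (geom_bound H (θ n) δ hδ (hθ n hn)) _
  have hmain : dg * #A ≤ #A * (1 / (2 * δ)) ^ (2 * r) +
      ‖∑ q ∈ V ×ˢ V with ¬ s q.1 = s q.2, ∑ n ∈ A, ee (((s q.1 : ℝ) - s q.2) * θ n)‖ := by
    have e1 := eq_sub_of_add_eq htot.symm
    have e2 := congrArg norm e1
    have e3 := norm_sub_le ((∑ n ∈ A, ‖∑ h ∈ range H, ee (h * θ n)‖ ^ (2 * r) : ℝ) : ℂ)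
      (∑ q ∈ V ×ˢ V with ¬ s q.1 = s q.2, ∑ n ∈ A, ee (((s q.1 : ℝ) - s q.2) * θ n))
    rw [← e2, norm_mul, Complex.norm_natCast, Complex.norm_natCast, Complex.norm_real,
      Real.norm_of_nonneg (Finset.sum_nonneg fun _ _ => by positivity)] at e3
    linarith
  have hPe : P * (2 * r * H) = #A := by
    rw [hP]
    field_simp
  have hApos : (0 : ℝ) < #A := by rw [← hPe]; positivity
  have c1 : P * (2 * r * H) * (1 / (2 * δ)) ^ (2 * r) ≤ P * (H : ℝ) ^ (2 * r) := by
    rw [mul_assoc P]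
    exact mul_le_mul_of_nonneg_left hcond hPpos.le
  have c2 : 2 * P * (H : ℝ) ^ (2 * r) ≤ 2 * P * (r * H * dg) := by gcongr
  rw [← hPe] at hmain
  linarith

end Four

end VMV


namespace VMV

open Finset

section Five

lemma ch_ee {K Q : ℕ} [NeZero Q] (g : Fin K → ℤ) (x : ℤ) :
    ch (fun j => ((g j : ℤ) : ZMod Q)) (mom K x) =
      ee (∑ j : Fin K, (g j : ℝ) / Q * (x : ℝ) ^ ((j : ℕ) + 1)) := by
  have h1 : (∑ j : Fin K, ((g j : ℤ) : ZMod Q) * ((mom K x j : ℤ) : ZMod Q)) =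
      ((∑ j : Fin K, g j * mom K x j : ℤ) : ZMod Q) := by push_cast; rfl
  unfold ch
  rw [h1, ZMod.stdAddChar_coe]
  unfold ee
  congr 1
  have h2 : (∑ j : Fin K, (g j : ℝ) / Q * (x : ℝ) ^ ((j : ℕ) + 1)) =
      ((∑ j : Fin K, g j * mom K x j : ℤ) : ℝ) / Q := by
    push_cast
    rw [Finset.sum_div]
    apply Finset.sum_congr rfl
    intro j _
    simp only [mom]
    push_cast
    ring
  rw [h2]
  push_cast
  ring

lemma collide {K : ℕ} (hK : 1 ≤ K) (t N Y : ℕ) (hN : 1 ≤ N) (P : ℝ) (hP : 0 < P) (hPN : P ≤ N)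
    (γ : ℕ → Fin K → ℝ) (a : ℤ → ℂ) (ha : ∀ x, ‖a x‖ ≤ 1)
    (hl : ∀ y < Y, 3 * P / 4 ≤
      ‖∑ x ∈ Ico (0 : ℤ) N, a x * ee (∑ j : Fin K, γ y j * (x : ℝ) ^ ((j : ℕ) + 1))‖)
    (hJ : (J K t N : ℝ) < Y * (P / 2) ^ (2 * t) *
      ∏ j : Fin K, ((P / (64 * K * (N : ℝ) ^ ((j : ℕ) + 2))) / 2)) :
    ∃ y y' : ℕ, y < y' ∧ y' < Y ∧ ∀ j : Fin K, ∃ z : ℤ,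
      |γ y' j - γ y j - z| ≤ 2 * (P / (64 * K * (N : ℝ) ^ ((j : ℕ) + 2))) := by
  have hKR : (1 : ℝ) ≤ K := by exact_mod_cast hK
  have hNR : (1 : ℝ) ≤ N := by exact_mod_cast hN
  set lam : Fin K → ℝ := fun j => P / (64 * K * (N : ℝ) ^ ((j : ℕ) + 2)) with hlam
  have hlpos : ∀ j, 0 < lam j := fun j => by simp only [hlam]; positivity
  have hl1 : ∀ j, lam j ≤ 1 := by
    intro j
    simp only [hlam]
    rw [div_le_one (by positivity)]
    have : (N : ℝ) ≤ (N : ℝ) ^ ((j : ℕ) + 2) := le_self_pow₀ hNR (by omega)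
    nlinarith
  set lm : ℝ := P / (64 * K * (N : ℝ) ^ (K + 2)) with hlm
  have hlmpos : 0 < lm := by rw [hlm]; positivity
  have hlml : ∀ j, lm ≤ lam j := by
    intro j
    simp only [hlam, hlm]
    gcongr
    exact j.2.le
  obtain ⟨Q, hQ⟩ := exists_nat_gt (max ((t * N ^ K : ℕ) : ℝ) (1 / lm))
  have hQ1 : t * N ^ K < Q := by
    have := lt_of_le_of_lt (le_max_left _ _) hQ
    exact_mod_cast this
  have hQ2 : 1 / lm < Q := lt_of_le_of_lt (le_max_right _ _) hQ
  have : NeZero Q := ⟨by omega⟩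
  have hQpos : (0 : ℝ) < Q := lt_trans (by positivity) hQ2
  have hQl : ∀ j, 1 ≤ Q * lam j := by
    intro j
    rw [div_lt_iff₀ hlmpos] at hQ2
    have := mul_le_mul_of_nonneg_left (hlml j) hQpos.le
    linarith
  set m : Fin K → ℕ := fun j => ⌊Q * lam j⌋₊ with hm
  have hm1 : ∀ j, (m j : ℝ) ≤ Q * lam j := fun j => Nat.floor_le (by linarith [hQl j])
  have hm2 : ∀ j, Q * (lam j / 2) ≤ m j := by
    intro j
    have h1 : Q * lam j < m j + 1 := Nat.lt_floor_add_one _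
    have h2 : (1 : ℝ) ≤ m j := by
      have : 1 ≤ m j := Nat.le_floor (by simpa using hQl j)
      exact_mod_cast this
    linarith
  have hmQ : ∀ j, (m j : ℝ) ≤ Q := fun j => (hm1 j).trans (by nlinarith [hl1 j])
  set I := Fintype.piFinset (fun j : Fin K => range (m j)) with hI
  set D := range Y ×ˢ I with hD
  set g : ℕ × (Fin K → ℕ) → Fin K → ℤ := fun q j => ⌊Q * γ q.1 j⌋ - (q.2 j : ℤ) with hg
  set Φ : ℕ × (Fin K → ℕ) → (Fin K → ZMod Q) := fun q j => ((g q j : ℤ) : ZMod Q) with hΦ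
  have hgap : ∀ q ∈ D, ∀ j, |γ q.1 j - (g q j : ℝ) / Q| ≤ lam j := by
    intro q hq j
    rw [hD, Finset.mem_product, hI, Fintype.mem_piFinset] at hq
    have h1 : (q.2 j : ℝ) + 1 ≤ m j := by
      have := Finset.mem_range.1 (hq.2 j)
      exact_mod_cast this
    have h2 := Int.floor_le (Q * γ q.1 j)
    have h3 := Int.lt_floor_add_one (Q * γ q.1 j)
    have h4 : γ q.1 j - (g q j : ℝ) / Q = (Q * γ q.1 j - ⌊Q * γ q.1 j⌋ + q.2 j) / Q := by
      simp only [hg]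
      push_cast
      field_simp
      ring
    have h5 : (0 : ℝ) ≤ q.2 j := by positivity
    rw [h4, abs_div, abs_of_pos hQpos, div_le_iff₀ hQpos, abs_of_nonneg (by linarith)]
    linarith [hm1 j]
  have hbig : ∀ q ∈ D, P / 2 ≤ ‖∑ x ∈ Ico (0 : ℤ) N, a x * ch (Φ q) (mom K x)‖ := by
    intro q hq
    have hy : q.1 < Y := by
      rw [hD, Finset.mem_product] at hq
      exact Finset.mem_range.1 hq.1
    have h1 := hl q.1 hy
    have h2 : ‖∑ x ∈ Ico (0 : ℤ) N, a x * ee (∑ j : Fin K, γ q.1 j * (x : ℝ) ^ ((j : ℕ) + 1)) -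
        ∑ x ∈ Ico (0 : ℤ) N, a x * ch (Φ q) (mom K x)‖ ≤ P / 4 := by
      rw [← Finset.sum_sub_distrib]
      have h3 : ∀ x ∈ Ico (0 : ℤ) N,
          ‖a x * ee (∑ j : Fin K, γ q.1 j * (x : ℝ) ^ ((j : ℕ) + 1)) -
            a x * ch (Φ q) (mom K x)‖ ≤ P / (4 * N) := by
        intro x hx
        rw [Finset.mem_Ico] at hx
        have hx0 : (0 : ℝ) ≤ x := by exact_mod_cast hx.1
        have hxN : (x : ℝ) ≤ N := by exact_mod_cast hx.2.le
        rw [hΦ, ch_ee, ← mul_sub, norm_mul]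
        refine (mul_le_of_le_one_left (norm_nonneg _) (ha x)).trans ?_
        refine (ee_sub_le _ _).trans ?_
        rw [← Finset.sum_sub_distrib]
        have h4 : |∑ j : Fin K, (γ q.1 j * (x : ℝ) ^ ((j : ℕ) + 1) -
            (g q j : ℝ) / Q * (x : ℝ) ^ ((j : ℕ) + 1))| ≤ ∑ _j : Fin K, P / (64 * K * N) := by
          refine (Finset.abs_sum_le_sum_abs _ _).trans (Finset.sum_le_sum fun j _ => ?_)
          rw [← sub_mul, abs_mul, abs_of_nonneg (pow_nonneg hx0 _)]
          calc |γ q.1 j - (g q j : ℝ) / Q| * (x : ℝ) ^ ((j : ℕ) + 1)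
              ≤ lam j * (N : ℝ) ^ ((j : ℕ) + 1) := by
                have := hgap q hq j
                have := (hlpos j).le
                gcongr
            _ = P / (64 * K * N) := by
                simp only [hlam]
                field_simp
                ring
        rw [Finset.sum_const, Finset.card_univ, Fintype.card_fin, nsmul_eq_mul] at h4
        have h5 : (K : ℝ) * (P / (64 * K * N)) = P / (4 * N) / 16 := by
          field_simp
          ring
        rw [h5] at h4
        have h6 : 0 < P / (4 * N) := by positivity
        have := Real.pi_le_four
        have := Real.pi_pos
        nlinarith [abs_nonneg (∑ j : Fin K, (γ q.1 j * (x : ℝ) ^ ((j : ℕ) + 1) -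
            (g q j : ℝ) / Q * (x : ℝ) ^ ((j : ℕ) + 1)))]
      refine (norm_sum_le_of_le _ h3).trans ?_
      rw [Finset.sum_const, Int.card_Ico, nsmul_eq_mul]
      simp only [sub_zero, Int.toNat_natCast]
      apply le_of_eq
      field_simp
    have h3 := norm_sub_norm_le
      (∑ x ∈ Ico (0 : ℤ) N, a x * ee (∑ j : Fin K, γ q.1 j * (x : ℝ) ^ ((j : ℕ) + 1)))
      (∑ x ∈ Ico (0 : ℤ) N, a x * ch (Φ q) (mom K x))
    linarith
  have hninj : ¬ Set.InjOn Φ D := by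
    intro hinj
    have h1 : ∑ q ∈ D, ‖∑ x ∈ Ico (0 : ℤ) N, a x * ch (Φ q) (mom K x)‖ ^ (2 * t) ≤
        ∑ α : Fin K → ZMod Q, ‖∑ x ∈ Ico (0 : ℤ) N, a x * ch α (mom K x)‖ ^ (2 * t) := by
      rw [← Finset.sum_image (f := fun α : Fin K → ZMod Q =>
        ‖∑ x ∈ Ico (0 : ℤ) N, a x * ch α (mom K x)‖ ^ (2 * t)) hinj]
      exact Finset.sum_le_sum_of_subset_of_nonneg (Finset.subset_univ _)
        (fun _ _ _ => by positivity)
    have h2 := wrap (k := K) (Q := Q) t N (Ico (0 : ℤ) N)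
      (fun x hx => by rw [Finset.mem_Ico] at hx; exact hx) hQ1 a ha
    have h3 : (#D : ℝ) * (P / 2) ^ (2 * t) ≤
        ∑ q ∈ D, ‖∑ x ∈ Ico (0 : ℤ) N, a x * ch (Φ q) (mom K x)‖ ^ (2 * t) := by
      rw [← nsmul_eq_mul]
      apply Finset.card_nsmul_le_sum
      intro q hq
      exact pow_le_pow_left₀ (by positivity) (hbig q hq) _
    have h4 : (Q : ℝ) ^ K * ∏ j : Fin K, (lam j / 2) ≤ ∏ j : Fin K, (m j : ℝ) := by
      have : (Q : ℝ) ^ K = ∏ _j : Fin K, (Q : ℝ) := by simp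
      rw [this, ← Finset.prod_mul_distrib]
      apply Finset.prod_le_prod
      · intro j _
        have := hlpos j
        positivity
      · intro j _
        exact hm2 j
    have h5 : (#D : ℝ) = Y * ∏ j : Fin K, (m j : ℝ) := by
      rw [hD, Finset.card_product, hI, Fintype.card_piFinset]
      simp
    unfold E at h2
    rw [div_le_iff₀ (by positivity)] at h2
    have h6 : (Y : ℝ) * (P / 2) ^ (2 * t) * ((Q : ℝ) ^ K * ∏ j : Fin K, (lam j / 2)) ≤
        Y * (P / 2) ^ (2 * t) * ∏ j : Fin K, (m j : ℝ) := by gcongr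
    have h7 := mul_lt_mul_of_pos_right hJ (show (0 : ℝ) < (Q : ℝ) ^ K by positivity)
    have h8 : (J K t N : ℝ) = #(sols K t (Ico (0 : ℤ) N)) := rfl
    rw [h8] at h7
    rw [h5] at h3
    have h9 : (Y : ℝ) * (∏ j : Fin K, (m j : ℝ)) * (P / 2) ^ (2 * t) =
      Y * (P / 2) ^ (2 * t) * ∏ j : Fin K, (m j : ℝ) := by ring
    have h10 : (Y : ℝ) * (P / 2) ^ (2 * t) * ((Q : ℝ) ^ K * ∏ j : Fin K, (lam j / 2)) =
      Y * (P / 2) ^ (2 * t) * (∏ j : Fin K, (lam j / 2)) * (Q : ℝ) ^ K := by ring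
    linarith
  have key : ∃ q ∈ D, ∃ q' ∈ D, Φ q = Φ q' ∧ q.1 < q'.1 := by
    unfold Set.InjOn at hninj
    push Not at hninj
    obtain ⟨q, hq, q', hq', he, hne⟩ := hninj
    rw [Finset.mem_coe] at hq hq'
    rcases lt_trichotomy q.1 q'.1 with h | h | h
    · exact ⟨q, hq, q', hq', he, h⟩
    · exfalso
      apply hne
      refine Prod.ext h ?_
      funext j
      have h1 := congrFun he j
      simp only [hΦ] at h1
      rw [ZMod.intCast_eq_intCast_iff_dvd_sub] at h1
      simp only [hg] at h1
      rw [h] at h1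
      have b := hmQ j
      have b' : m j ≤ Q := by exact_mod_cast b
      rw [hD, Finset.mem_product, hI, Fintype.mem_piFinset] at hq hq'
      have b1 := Finset.mem_range.1 (hq.2 j)
      have b2 := Finset.mem_range.1 (hq'.2 j)
      have h2 : (Q : ℤ) ∣ (q.2 j : ℤ) - q'.2 j := by
        have e : ⌊(Q : ℝ) * γ q'.1 j⌋ - (q'.2 j : ℤ) - (⌊(Q : ℝ) * γ q'.1 j⌋ - (q.2 j : ℤ)) =
          (q.2 j : ℤ) - q'.2 j := by ring
        rwa [e] at h1
      have h3 := Int.eq_zero_of_abs_lt_dvd h2 (by rw [abs_lt]; constructor <;> omega)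
      omega
    · exact ⟨q', hq', q, hq, he.symm, h⟩
  obtain ⟨q, hq, q', hq', he, hlt⟩ := key
  have hY : q'.1 < Y := by
    rw [hD, Finset.mem_product] at hq'
    exact Finset.mem_range.1 hq'.1
  refine ⟨q.1, q'.1, hlt, hY, fun j => ?_⟩
  have h1 := congrFun he j
  simp only [hΦ] at h1
  rw [ZMod.intCast_eq_intCast_iff_dvd_sub] at h1
  obtain ⟨z, hz⟩ := h1
  refine ⟨z, ?_⟩
  have h2 := hgap q hq j
  have h3 := hgap q' hq' j
  have h4 : (z : ℝ) = (g q' j : ℝ) / Q - (g q j : ℝ) / Q := by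
    have : ((g q' j - g q j : ℤ) : ℝ) = ((Q * z : ℤ) : ℝ) := by rw [hz]
    push_cast at this
    field_simp
    linarith
  rw [h4, abs_le]
  rw [abs_le] at h2 h3
  constructor <;> linarith [h2.1, h2.2, h3.1, h3.2]

end Five

end VMV


namespace VMV

open Finset

section Six

lemma elim_coeff (k : ℕ) (W : ℝ) (hW : 0 ≤ W) : ∀ m : ℕ, m < k → ∃ c : ℕ, 1 ≤ c ∧ ∃ M : ℝ, 0 ≤ M ∧
    ∀ (b : ℕ → ℝ) (w : ℕ → ℕ → ℤ) (N P : ℝ), 1 ≤ N → 0 ≤ P →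
    (∀ j, 1 ≤ j → j < k → ∃ z : ℤ,
      |((j : ℝ) + 1) * b (j + 1) + ∑ i ∈ Ioc (j + 1) k, (w j i : ℝ) * b i - z| ≤ P / N ^ (j + 1)) →
    (∀ j i, j + 1 < i → i ≤ k → |(w j i : ℝ)| ≤ W * N ^ (i - (j + 1))) →
    ∀ i, k < i + m → i ≤ k → ∃ z : ℤ, |(c : ℝ) * b i - z| ≤ M * P / N ^ i := by
  intro m
  induction m with
  | zero =>
    intro _
    refine ⟨1, le_rfl, 0, le_rfl, ?_⟩
    intro b w N P _ _ _ _ i h1 h2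
    omega
  | succ m ih =>
    intro hm
    obtain ⟨c, hc, M, hM, H⟩ := ih (by omega)
    obtain ⟨j, hj⟩ : ∃ j, k - m = j + 1 := ⟨k - m - 1, by omega⟩
    refine ⟨(j + 1) * c, by nlinarith, (j + 1) * M + c + k * (W * M), by positivity, ?_⟩
    intro b w N P hN hP h1 h2 i hi hik
    have H' := H b w N P hN hP h1 h2
    have hN0 : 0 < N := by linarith
    rcases Nat.lt_or_ge k (i + m) with hlt | hge
    · obtain ⟨z, hz⟩ := H' i hlt hik
      refine ⟨(j + 1) * z, ?_⟩
      have e : (((j + 1) * c : ℕ) : ℝ) * b i - (((j + 1) * z : ℤ) : ℝ) =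
          ((j : ℝ) + 1) * (c * b i - z) := by push_cast; ring
      rw [e, abs_mul, abs_of_nonneg (by positivity)]
      calc ((j : ℝ) + 1) * |c * b i - z| ≤ (j + 1) * (M * P / N ^ i) := by gcongr
        _ = ((j + 1) * M) * P / N ^ i := by ring
        _ ≤ ((j + 1) * M + c + k * (W * M)) * P / N ^ i := by
            have : 0 ≤ k * (W * M) := by positivity
            gcongr
            have : (0 : ℝ) ≤ c := by positivity
            linarith
    · have hij : i = j + 1 := by omega
      subst hij
      obtain ⟨z0, hz0⟩ := h1 j (by omega) (by omega)
      have hall : ∀ l, ∃ z : ℤ, l ∈ Ioc (j + 1) k → |(c : ℝ) * b l - z| ≤ M * P / N ^ l := by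
        intro l
        by_cases hl : l ∈ Ioc (j + 1) k
        · rw [Finset.mem_Ioc] at hl
          obtain ⟨z, hz⟩ := H' l (by omega) hl.2
          exact ⟨z, fun _ => hz⟩
        · exact ⟨0, fun h => absurd h hl⟩
      choose zz hzz using hall
      refine ⟨c * z0 - ∑ l ∈ Ioc (j + 1) k, w j l * zz l, ?_⟩
      have e : (((j + 1) * c : ℕ) : ℝ) * b (j + 1) -
          ((c * z0 - ∑ l ∈ Ioc (j + 1) k, w j l * zz l : ℤ) : ℝ) =
          c * (((j : ℝ) + 1) * b (j + 1) + ∑ i ∈ Ioc (j + 1) k, (w j i : ℝ) * b i - z0) -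
          ∑ l ∈ Ioc (j + 1) k, (w j l : ℝ) * (c * b l - zz l) := by
        push_cast
        simp_rw [mul_sub]
        rw [Finset.sum_sub_distrib, mul_add, Finset.mul_sum]
        have : ∀ l, (w j l : ℝ) * (c * b l) = c * (w j l * b l) := fun l => by ring
        simp_rw [this]
        ring
      rw [e]
      refine (abs_sub _ _).trans ?_
      have t1 : |(c : ℝ) * (((j : ℝ) + 1) * b (j + 1) +
          ∑ i ∈ Ioc (j + 1) k, (w j i : ℝ) * b i - z0)| ≤ c * (P / N ^ (j + 1)) := by
        rw [abs_mul, abs_of_nonneg (by positivity)]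
        gcongr
      have t2 : |∑ l ∈ Ioc (j + 1) k, (w j l : ℝ) * (c * b l - zz l)| ≤
          k * (W * M * P / N ^ (j + 1)) := by
        refine (Finset.abs_sum_le_sum_abs _ _).trans ?_
        have t3 : ∀ l ∈ Ioc (j + 1) k, |(w j l : ℝ) * (c * b l - zz l)| ≤
            W * M * P / N ^ (j + 1) := by
          intro l hl
          have hl' := Finset.mem_Ioc.1 hl
          rw [abs_mul]
          calc |(w j l : ℝ)| * |c * b l - zz l| ≤
              (W * N ^ (l - (j + 1))) * (M * P / N ^ l) := by
                have a1 := h2 j l hl'.1 hl'.2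
                have a2 := hzz l hl
                gcongr
            _ = W * M * P / N ^ (j + 1) := by
                have : N ^ l = N ^ (l - (j + 1)) * N ^ (j + 1) := by
                  rw [← pow_add]; congr 1; omega
                rw [this]
                field_simp
        refine (Finset.sum_le_card_nsmul _ _ _ t3).trans ?_
        rw [nsmul_eq_mul, Nat.card_Ioc]
        gcongr
        omega
      calc _ ≤ c * (P / N ^ (j + 1)) + k * (W * M * P / N ^ (j + 1)) := add_le_add t1 t2
        _ = (c + k * (W * M)) * P / N ^ (j + 1) := by ring
        _ ≤ _ := by
          gcongr
          have : 0 ≤ ((j : ℝ) + 1) * M := by positivity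
          linarith

/-- shifted coefficients -/
noncomputable def gam (k : ℕ) (β : ℕ → ℝ) (y j : ℕ) : ℝ :=
  ∑ i ∈ range (k + 1), (i.choose j : ℝ) * β i * (y : ℝ) ^ (i - j)

lemma shift_expand (k : ℕ) (β : ℕ → ℝ) (x : ℝ) (y : ℕ) :
    ∑ i ∈ range (k + 1), β i * (x + y) ^ i = ∑ j ∈ range (k + 1), gam k β y j * x ^ j := by
  unfold gam
  simp_rw [Finset.sum_mul]
  rw [Finset.sum_comm]
  apply Finset.sum_congr rfl
  intro i hi
  rw [add_pow, Finset.mul_sum]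
  have hik : i + 1 ≤ k + 1 := by rw [Finset.mem_range] at hi; omega
  rw [Finset.sum_subset (Finset.range_mono hik)]
  · apply Finset.sum_congr rfl
    intro j _
    ring
  · intro j _ hj
    rw [Finset.mem_range] at hj
    rw [Nat.choose_eq_zero_of_lt (by omega)]
    simp

lemma gam_top (k : ℕ) (β : ℕ → ℝ) (y : ℕ) : gam k β y k = β k := by
  unfold gam
  rw [Finset.sum_range_succ, Finset.sum_eq_zero]
  · simp
  · intro i hi
    rw [Finset.mem_range] at hi
    rw [Nat.choose_eq_zero_of_lt hi]
    simp

lemma gam_sub (k : ℕ) : ∃ W : ℝ, 0 ≤ W ∧ ∀ y y' N : ℕ, 1 ≤ N → y ≤ N → y' ≤ N → y < y' →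
    ∃ w : ℕ → ℕ → ℤ, (∀ j i, j + 1 < i → i ≤ k → |(w j i : ℝ)| ≤ W * (N : ℝ) ^ (i - (j + 1))) ∧
    ∀ (β : ℕ → ℝ) (j : ℕ), j < k → gam k β y' j - gam k β y j =
      ((j : ℝ) + 1) * (((y' - y : ℕ) : ℝ) * β (j + 1)) +
        ∑ i ∈ Ioc (j + 1) k, (w j i : ℝ) * (((y' - y : ℕ) : ℝ) * β i) := by
  refine ⟨2 ^ k * k, by positivity, ?_⟩
  intro y y' N hN hy hy' hlt
  set u : ℕ → ℤ := fun m => ∑ a ∈ range m, (y' : ℤ) ^ a * (y : ℤ) ^ (m - 1 - a) with hu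
  have hu1 : ∀ m : ℕ, (y' : ℝ) ^ m - (y : ℝ) ^ m = (u m : ℝ) * ((y' - y : ℕ) : ℝ) := by
    intro m
    rw [Nat.cast_sub hlt.le, hu]
    push_cast
    rw [geom_sum₂_mul]
  have hN1 : (1 : ℝ) ≤ N := by exact_mod_cast hN
  have hyR : (y : ℝ) ≤ N := by exact_mod_cast hy
  have hyR' : (y' : ℝ) ≤ N := by exact_mod_cast hy'
  refine ⟨fun j i => (i.choose j : ℤ) * u (i - j), ?_, ?_⟩
  · intro j i hji hik
    push_cast
    rw [abs_mul, abs_of_nonneg (by positivity)]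
    have b1 : (i.choose j : ℝ) ≤ 2 ^ k := by
      have : i.choose j ≤ 2 ^ k := (Nat.choose_le_two_pow i j).trans
        (Nat.pow_le_pow_right (by norm_num) hik)
      exact_mod_cast this
    have b2 : |(u (i - j) : ℝ)| ≤ k * (N : ℝ) ^ (i - (j + 1)) := by
      rw [hu]
      push_cast
      refine (Finset.abs_sum_le_sum_abs _ _).trans ?_
      have : ∀ a ∈ range (i - j), |(y' : ℝ) ^ a * (y : ℝ) ^ (i - j - 1 - a)| ≤
          (N : ℝ) ^ (i - (j + 1)) := by
        intro a ha
        rw [Finset.mem_range] at ha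
        rw [abs_of_nonneg (by positivity)]
        calc (y' : ℝ) ^ a * (y : ℝ) ^ (i - j - 1 - a) ≤ (N : ℝ) ^ a * (N : ℝ) ^ (i - j - 1 - a) := by
              gcongr
          _ = (N : ℝ) ^ (i - (j + 1)) := by rw [← pow_add]; congr 1; omega
      refine (Finset.sum_le_card_nsmul _ _ _ this).trans ?_
      rw [nsmul_eq_mul, Finset.card_range]
      gcongr
      omega
    calc (i.choose j : ℝ) * |(u (i - j) : ℝ)| ≤ 2 ^ k * (k * (N : ℝ) ^ (i - (j + 1))) := by gcongr
      _ = _ := by ring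
  · intro β j hj
    unfold gam
    rw [← Finset.sum_sub_distrib]
    have h1 : ∀ i ∈ range (k + 1), (i.choose j : ℝ) * β i * (y' : ℝ) ^ (i - j) -
        (i.choose j : ℝ) * β i * (y : ℝ) ^ (i - j) =
        (((i.choose j : ℤ) * u (i - j) : ℤ) : ℝ) * (((y' - y : ℕ) : ℝ) * β i) := by
      intro i _
      rw [← mul_sub, hu1]
      push_cast
      ring
    rw [Finset.sum_congr rfl h1]
    have h2 : ∑ i ∈ range (k + 1), (((i.choose j : ℤ) * u (i - j) : ℤ) : ℝ) *
        (((y' - y : ℕ) : ℝ) * β i) = ∑ i ∈ insert (j + 1) (Ioc (j + 1) k),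
          (((i.choose j : ℤ) * u (i - j) : ℤ) : ℝ) * (((y' - y : ℕ) : ℝ) * β i) := by
      symm
      apply Finset.sum_subset
      · intro i hi
        rw [Finset.mem_insert, Finset.mem_Ioc] at hi
        rw [Finset.mem_range]
        omega
      · intro i hi hi'
        rw [Finset.mem_insert, Finset.mem_Ioc] at hi'
        rw [Finset.mem_range] at hi
        have : i - j = 0 := by omega
        rw [this]
        simp [hu]
    rw [h2, Finset.sum_insert (by simp)]
    congr 1
    have : j + 1 - j = 1 := by omega
    rw [this]
    simp [hu]

lemma shift_norm (f : ℕ → ℂ) (hf : ∀ n, ‖f n‖ ≤ 1) (N y : ℕ) :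
    ‖∑ n ∈ range N, f n‖ - 2 * y ≤ ‖∑ n ∈ range N, f (n + y)‖ := by
  induction y with
  | zero => simp
  | succ y ih =>
    have h1 : ∑ n ∈ range N, f (n + (y + 1)) = ∑ n ∈ range N, f (n + y) + (f (N + y) - f (0 + y)) := by
      have a := Finset.sum_range_succ (fun n => f (n + y)) N
      have b := Finset.sum_range_succ' (fun n => f (n + y)) N
      have c : ∀ n, n + 1 + y = n + (y + 1) := fun n => by ring
      simp_rw [c] at b
      rw [a] at b
      linear_combination -b
    have h2 : ‖f (N + y) - f (0 + y)‖ ≤ 2 := by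
      refine (norm_sub_le _ _).trans ?_
      linarith [hf (N + y), hf (0 + y)]
    have h3 := norm_sub_le (∑ n ∈ range N, f (n + (y + 1))) (f (N + y) - f (0 + y))
    have h4 : ∑ n ∈ range N, f (n + (y + 1)) - (f (N + y) - f (0 + y)) =
      ∑ n ∈ range N, f (n + y) := by rw [h1]; ring
    rw [h4] at h3
    push_cast
    linarith

lemma sum_Ico_range (N : ℕ) (g : ℤ → ℂ) :
    ∑ x ∈ Ico (0 : ℤ) N, g x = ∑ n ∈ range N, g (n : ℤ) := by
  induction N with
  | zero => simp
  | succ N ih =>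
    rw [Finset.sum_range_succ, ← ih]
    have : Ico (0 : ℤ) ((N + 1 : ℕ) : ℤ) = insert (N : ℤ) (Ico (0 : ℤ) N) := by
      ext x
      simp only [Finset.mem_insert, Finset.mem_Ico]
      push_cast
      omega
    rw [this, Finset.sum_insert (by simp), add_comm]

lemma rational_approx (K : ℕ) (hK : 1 ≤ K) : ∃ c : ℕ, 1 ≤ c ∧ ∃ M : ℝ, 0 ≤ M ∧
    ∀ (t N Y : ℕ) (P : ℝ) (β : ℕ → ℝ), 1 ≤ N → 0 < P → P ≤ N → 8 * (Y : ℝ) ≤ P →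
    P ≤ ‖∑ n ∈ range N, ee (∑ i ∈ range (K + 2), β i * ((n : ℝ) + 1) ^ i)‖ →
    (J K t N : ℝ) < Y * (P / 2) ^ (2 * t) *
      ∏ j : Fin K, ((P / (64 * K * (N : ℝ) ^ ((j : ℕ) + 2))) / 2) →
    ∃ d : ℕ, 1 ≤ d ∧ d ≤ Y ∧ ∀ i, 2 ≤ i → i ≤ K + 1 →
      ∃ z : ℤ, |((c * d : ℕ) : ℝ) * β i - z| ≤ M * P / (N : ℝ) ^ i := by
  obtain ⟨W, hW, HW⟩ := gam_sub (K + 1)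
  obtain ⟨c, hc, M, hM, H⟩ := elim_coeff (K + 1) W hW K (by omega)
  refine ⟨c, hc, M, hM, ?_⟩
  intro t N Y P β hN hP hPN hY hS hJ
  have hKR : (1 : ℝ) ≤ K := by exact_mod_cast hK
  have hNR : (1 : ℝ) ≤ N := by exact_mod_cast hN
  have hsplit : ∀ (x : ℝ) (y : ℕ), ∑ i ∈ range (K + 2), β i * (x + y) ^ i =
      gam (K + 1) β y 0 + (β (K + 1) * x ^ (K + 1) +
        ∑ j : Fin K, gam (K + 1) β y ((j : ℕ) + 1) * x ^ ((j : ℕ) + 1)) := by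
    intro x y
    rw [shift_expand (K + 1) β x y, Finset.sum_range_succ, gam_top, Finset.sum_range_succ',
      Finset.sum_range]
    ring
  have hlarge : ∀ y < Y, 3 * P / 4 ≤ ‖∑ x ∈ Ico (0 : ℤ) N, ee (β (K + 1) * (x : ℝ) ^ (K + 1)) *
      ee (∑ j : Fin K, gam (K + 1) β (y + 1) ((j : ℕ) + 1) * (x : ℝ) ^ ((j : ℕ) + 1))‖ := by
    intro y hy
    have h1 := shift_norm (fun n => ee (∑ i ∈ range (K + 2), β i * ((n : ℝ) + 1) ^ i))
      (fun n => (ee_norm _).le) N y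
    have h2 : ∑ n ∈ range N, ee (∑ i ∈ range (K + 2), β i * (((n + y : ℕ) : ℝ) + 1) ^ i) =
        ee (gam (K + 1) β (y + 1) 0) * ∑ x ∈ Ico (0 : ℤ) N, ee (β (K + 1) * (x : ℝ) ^ (K + 1)) *
      ee (∑ j : Fin K, gam (K + 1) β (y + 1) ((j : ℕ) + 1) * (x : ℝ) ^ ((j : ℕ) + 1)) := by
      rw [sum_Ico_range, Finset.mul_sum]
      apply Finset.sum_congr rfl
      intro n _
      rw [← ee_add, ← ee_add]
      congr 1
      rw [Int.cast_natCast, ← hsplit (n : ℝ) (y + 1)]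
      apply Finset.sum_congr rfl
      intro i _
      push_cast
      ring
    have h3 : (y : ℝ) ≤ Y := by exact_mod_cast hy.le
    beta_reduce at h1
    rw [h2, norm_mul, ee_norm, one_mul] at h1
    linarith
  obtain ⟨y, y', hlt, hyY, hz⟩ := collide hK t N Y hN P hP hPN
    (fun y j => gam (K + 1) β (y + 1) ((j : ℕ) + 1)) (fun x => ee (β (K + 1) * (x : ℝ) ^ (K + 1)))
    (fun x => (ee_norm _).le) hlarge hJ
  have hYN : Y ≤ N := by
    have : (Y : ℝ) ≤ N := by
      have : (0 : ℝ) ≤ Y := by positivity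
      linarith
    exact_mod_cast this
  obtain ⟨w, hw1, hw2⟩ := HW (y + 1) (y' + 1) N hN (by omega) (by omega) (by omega)
  have e1 : y' + 1 - (y + 1) = y' - y := by omega
  rw [e1] at hw2
  refine ⟨y' - y, by omega, by omega, ?_⟩
  intro i hi hiK
  have hfin := H (fun i => ((y' - y : ℕ) : ℝ) * β i) w N P hNR hP.le ?_ hw1 i (by omega) hiK
  · obtain ⟨z, hz⟩ := hfin
    refine ⟨z, ?_⟩
    push_cast
    rw [mul_assoc]
    exact hz
  · intro j hj hjK
    obtain ⟨z, hz⟩ := hz ⟨j - 1, by omega⟩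
    have e2 : j - 1 + 1 = j := by omega
    have e3 : j - 1 + 2 = j + 1 := by omega
    simp only [e2, e3] at hz
    rw [hw2 β j hjK] at hz
    refine ⟨z, hz.trans ?_⟩
    have : P / (64 * K * (N : ℝ) ^ (j + 1)) = P / (N : ℝ) ^ (j + 1) / (64 * K) := by
      field_simp
    rw [this]
    have h0 : 0 < P / (N : ℝ) ^ (j + 1) := by positivity
    rw [← mul_div_assoc, div_le_iff₀ (by positivity)]
    nlinarith

end Six

end VMV


namespace VMV

open Finset

section Seven

lemma final_step (K : ℕ) (α : ℕ → ℝ) (hα0 : α 0 = 0) (N q h T : ℕ) (hN : 1 ≤ N) (hq : 1 ≤ q)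
    (hh : 1 ≤ h) (hT : 1 ≤ T) (B δ : ℝ) (hB : 0 ≤ B)
    (hz : ∀ i, 2 ≤ i → i ≤ K + 1 → ∃ z : ℤ, |((q * h : ℕ) : ℝ) * α i - z| ≤ B / (N : ℝ) ^ (i - 1))
    (hle : q * h * T ≤ N)
    (hδ : 1 / ((T : ℝ) + 1) + K * (T * B * (((q * h * T : ℕ) : ℝ) / N)) < δ) :
    ∃ n : ℕ, 1 ≤ n ∧ n ≤ N ∧ |(∑ i ∈ range (K + 2), α i * (n : ℝ) ^ i) -
      round (∑ i ∈ range (K + 2), α i * (n : ℝ) ^ i)| < δ := by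
  obtain ⟨u, hu0, huT, hu⟩ := Real.exists_nat_abs_mul_sub_round_le
    (((q * h : ℕ) : ℝ) * α 1) hT
  set n := q * h * u with hn
  have hnN : n ≤ N := (Nat.mul_le_mul_left _ huT).trans hle
  have hn1 : 1 ≤ n := by
    have : 0 < q * h * u := by positivity
    exact this
  refine ⟨n, hn1, hnN, ?_⟩
  have hNR : (0 : ℝ) < N := by exact_mod_cast hN
  have hterm : ∀ i ∈ range K, ∃ z : ℤ, |α (i + 2) * (n : ℝ) ^ (i + 2) - z| ≤
      T * B * (((q * h * T : ℕ) : ℝ) / N) := by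
    intro i hi
    rw [Finset.mem_range] at hi
    obtain ⟨z, hz⟩ := hz (i + 2) (by omega) (by omega)
    refine ⟨(n : ℤ) ^ (i + 1) * u * z, ?_⟩
    have e : α (i + 2) * (n : ℝ) ^ (i + 2) - (((n : ℤ) ^ (i + 1) * u * z : ℤ) : ℝ) =
        (n : ℝ) ^ (i + 1) * u * (((q * h : ℕ) : ℝ) * α (i + 2) - z) := by
      have : (n : ℝ) = ((q * h : ℕ) : ℝ) * u := by rw [hn]; push_cast; ring
      push_cast
      rw [pow_succ (n : ℝ) (i + 1)]
      nth_rewrite 2 [this]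
      push_cast
      ring
    rw [e, abs_mul, abs_of_nonneg (by positivity)]
    have e2 : i + 2 - 1 = i + 1 := by omega
    rw [e2] at hz
    have h1 : ((n : ℝ) / N) ^ (i + 1) ≤ (n : ℝ) / N := by
      apply pow_le_of_le_one (by positivity) _ (by omega)
      rw [div_le_one hNR]
      exact_mod_cast hnN
    have h2 : (n : ℝ) ≤ ((q * h * T : ℕ) : ℝ) := by
      exact_mod_cast Nat.mul_le_mul_left _ huT
    have h3 : (u : ℝ) ≤ T := by exact_mod_cast huT
    calc (n : ℝ) ^ (i + 1) * u * |((q * h : ℕ) : ℝ) * α (i + 2) - z| ≤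
        (n : ℝ) ^ (i + 1) * u * (B / (N : ℝ) ^ (i + 1)) := by gcongr
      _ = u * B * ((n : ℝ) / N) ^ (i + 1) := by rw [div_pow]; ring
      _ ≤ T * B * ((n : ℝ) / N) := by gcongr
      _ ≤ _ := by gcongr
  choose! zz hzz using hterm
  set Z : ℤ := ∑ i ∈ range K, zz i + round ((u : ℝ) * (((q * h : ℕ) : ℝ) * α 1)) with hZ
  refine lt_of_le_of_lt (round_le _ Z) (lt_of_le_of_lt ?_ hδ)
  rw [Finset.sum_range_succ', Finset.sum_range_succ', hα0]
  have e : ∑ i ∈ range K, α (i + 1 + 1) * (n : ℝ) ^ (i + 1 + 1) + α (0 + 1) * (n : ℝ) ^ (0 + 1) +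
      0 * (n : ℝ) ^ 0 - (Z : ℝ) = ((u : ℝ) * (((q * h : ℕ) : ℝ) * α 1) -
        round ((u : ℝ) * (((q * h : ℕ) : ℝ) * α 1))) +
      ∑ i ∈ range K, (α (i + 2) * (n : ℝ) ^ (i + 2) - zz i) := by
    rw [hZ, Finset.sum_sub_distrib, hn]
    push_cast
    ring
  rw [e]
  refine (abs_add_le _ _).trans (add_le_add hu ?_)
  refine (Finset.abs_sum_le_sum_abs _ _).trans ?_
  refine (Finset.sum_le_card_nsmul _ _ _ hzz).trans ?_
  rw [nsmul_eq_mul, Finset.card_range]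

lemma eventually_rpow (C a b : ℝ) (hab : a < b) :
    ∃ N₀ : ℕ, ∀ N : ℕ, N₀ ≤ N → C * (N : ℝ) ^ a ≤ (N : ℝ) ^ b := by
  have h1 : Filter.Tendsto (fun N : ℕ => ((N : ℝ)) ^ (b - a)) Filter.atTop Filter.atTop :=
    (tendsto_rpow_atTop (by linarith)).comp tendsto_natCast_atTop_atTop
  obtain ⟨N₀, hN₀⟩ := Filter.eventually_atTop.1 (h1.eventually_ge_atTop C)
  refine ⟨max N₀ 1, fun N hN => ?_⟩
  have hN1 : 1 ≤ N := le_trans (le_max_right _ _) hN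
  have hNR : (0 : ℝ) < N := by exact_mod_cast hN1
  have h2 := hN₀ N (le_trans (le_max_left _ _) hN)
  have h3 : (N : ℝ) ^ b = (N : ℝ) ^ (b - a) * (N : ℝ) ^ a := by
    rw [← Real.rpow_add hNR]
    congr 1
    ring
  rw [h3]
  have : 0 < (N : ℝ) ^ a := Real.rpow_pos_of_pos hNR a
  exact mul_le_mul_of_nonneg_right h2 this.le

lemma prod_pow_range (K : ℕ) (x : ℝ) :
    (∏ j : Fin K, x ^ ((j : ℕ) + 2)) ^ 2 = x ^ (K * (K + 3)) := by
  rw [← Finset.prod_range (fun j => x ^ (j + 2))]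
  induction K with
  | zero => simp
  | succ K ih =>
    rw [Finset.prod_range_succ, mul_pow, ih]
    rw [← pow_mul, ← pow_add]
    congr 1
    ring

/-- lower bound for the right side in the collision criterion -/
lemma rhs_lower (K t N : ℕ) (hK : 1 ≤ K) (ht : t = K * (K + 1)) (hN : 1 ≤ N) (P τ' σ Δ C' : ℝ)
    (hσ : σ = (2 * t + K) * τ' + Δ) (hC' : 0 < C') (Y : ℝ) (hY : C' * (N : ℝ) ^ σ < Y)
    (hP : (N : ℝ) ^ (1 - τ') / 400 ≤ P) :
    C' * ((1 / 800) ^ (2 * t) * (1 / (51200 * K)) ^ K) *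
      (N : ℝ) ^ (3 * K * (K + 1) / 2 + Δ : ℝ) < Y * (P / 2) ^ (2 * t) *
      ∏ j : Fin K, ((P / (64 * K * (N : ℝ) ^ ((j : ℕ) + 2))) / 2) := by
  have hNR : (0 : ℝ) < N := by exact_mod_cast hN
  have hKR : (0 : ℝ) < K := by exact_mod_cast hK
  have hx : 0 < (N : ℝ) ^ (1 - τ') := Real.rpow_pos_of_pos hNR _
  have hprod : ∏ j : Fin K, (N : ℝ) ^ ((j : ℕ) + 2) = (N : ℝ) ^ ((K : ℝ) * (K + 3) / 2) := by
    have h1 := prod_pow_range K (N : ℝ)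
    have h2 : ((N : ℝ) ^ ((K : ℝ) * (K + 3) / 2)) ^ 2 = (N : ℝ) ^ (K * (K + 3)) := by
      rw [← Real.rpow_natCast, ← Real.rpow_mul hNR.le, ← Real.rpow_natCast]
      congr 1
      push_cast
      ring
    rw [← h2] at h1
    exact (pow_left_inj₀ (Finset.prod_nonneg fun _ _ => by positivity) (by positivity)
      (by norm_num)).1 h1
  have hPpos : 0 < P := lt_of_lt_of_le (by positivity) hP
  have hpf : ∏ j : Fin K, ((P / (64 * K * (N : ℝ) ^ ((j : ℕ) + 2))) / 2) =
      (P / (128 * K)) ^ K * ((N : ℝ) ^ ((K : ℝ) * (K + 3) / 2))⁻¹ := by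
    rw [← hprod, ← Finset.prod_inv_distrib]
    have : (P / (128 * K)) ^ K = ∏ _j : Fin K, (P / (128 * K)) := by
      rw [Finset.prod_const, Finset.card_univ, Fintype.card_fin]
    rw [this, ← Finset.prod_mul_distrib]
    apply Finset.prod_congr rfl
    intro j _
    field_simp
    ring
  rw [hpf]
  have hlow : C' * (N : ℝ) ^ σ * (((N : ℝ) ^ (1 - τ') / 400) / 2) ^ (2 * t) *
      ((((N : ℝ) ^ (1 - τ') / 400) / (128 * K)) ^ K * ((N : ℝ) ^ ((K : ℝ) * (K + 3) / 2))⁻¹) =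
      C' * ((1 / 800) ^ (2 * t) * (1 / (51200 * K)) ^ K) *
      (N : ℝ) ^ (3 * K * (K + 1) / 2 + Δ : ℝ) := by
    have a1 : ((N : ℝ) ^ (1 - τ') / 400) / 2 = (1 / 800) * (N : ℝ) ^ (1 - τ') := by ring
    have a2 : ((N : ℝ) ^ (1 - τ') / 400) / (128 * K) = (1 / (51200 * K)) * (N : ℝ) ^ (1 - τ') := by
      field_simp
      ring
    rw [a1, a2, mul_pow, mul_pow]
    have a3 : (N : ℝ) ^ (3 * K * (K + 1) / 2 + Δ : ℝ) = (N : ℝ) ^ σ * ((N : ℝ) ^ (1 - τ')) ^ (2 * t) *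
      (((N : ℝ) ^ (1 - τ')) ^ K * ((N : ℝ) ^ ((K : ℝ) * (K + 3) / 2))⁻¹) := by
      rw [← Real.rpow_neg hNR.le, ← Real.rpow_mul_natCast hNR.le, ← Real.rpow_mul_natCast hNR.le,
        ← Real.rpow_add hNR, ← Real.rpow_add hNR, ← Real.rpow_add hNR]
      congr 1
      rw [hσ, ht]
      push_cast
      ring
    rw [a3]
    ring
  rw [← hlow]
  have hn2 : (0 : ℝ) < ((N : ℝ) ^ ((K : ℝ) * (K + 3) / 2))⁻¹ := by positivity
  calc C' * (N : ℝ) ^ σ * (((N : ℝ) ^ (1 - τ') / 400) / 2) ^ (2 * t) *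
      ((((N : ℝ) ^ (1 - τ') / 400) / (128 * K)) ^ K * ((N : ℝ) ^ ((K : ℝ) * (K + 3) / 2))⁻¹)
      ≤ C' * (N : ℝ) ^ σ * (P / 2) ^ (2 * t) *
        ((P / (128 * K)) ^ K * ((N : ℝ) ^ ((K : ℝ) * (K + 3) / 2))⁻¹) := by gcongr
    _ < Y * (P / 2) ^ (2 * t) *
        ((P / (128 * K)) ^ K * ((N : ℝ) ^ ((K : ℝ) * (K + 3) / 2))⁻¹) := by gcongr

lemma exponents (k : ℝ) (hk : 4 ≤ k) (τ : ℝ) (hτ : τ = 1 / (4 * k * (k - 2))) :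
    (2 * (k * (k - 1)) + (k - 1)) * (101 / 100 * τ) + 1 / 100 + 101 / 100 * τ + 3 * τ < 1 := by
  have hpos : 0 < 4 * k * (k - 2) := by nlinarith
  have h1 : τ * (4 * k * (k - 2)) = 1 := by rw [hτ]; exact one_div_mul_cancel hpos.ne'
  have hτpos : 0 < τ := by rw [hτ]; positivity
  have h2 : 0 < 194 / 100 * k ^ 2 - 691 / 100 * k - 3 := by nlinarith
  nlinarith [mul_pos hτpos h2]

set_option maxHeartbeats 1000000 in
lemma main_thm (k : ℕ) (hk : 4 ≤ k) (τ : ℝ) (hτ : τ = 1 / (4 * (k : ℝ) * ((k : ℝ) - 2))) :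
    ∃ N₀ : ℕ, ∀ (α : ℕ → ℝ), α 0 = 0 → ∀ N : ℕ, N₀ ≤ N → ∃ n : ℕ, 1 ≤ n ∧ n ≤ N ∧
      |(∑ i ∈ range (k + 1), α i * (n : ℝ) ^ i) -
        round (∑ i ∈ range (k + 1), α i * (n : ℝ) ^ i)| < (N : ℝ) ^ (-τ) := by
  obtain ⟨K, rfl⟩ : ∃ K, k = K + 1 := ⟨k - 1, by omega⟩
  have hK : 3 ≤ K := by omega
  have hkR : (4 : ℝ) ≤ ((K + 1 : ℕ) : ℝ) := by exact_mod_cast hk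
  have hexp := exponents _ hkR τ hτ
  have hτpos : 0 < τ := by
    rw [hτ]
    have : 0 < 4 * ((K + 1 : ℕ) : ℝ) * (((K + 1 : ℕ) : ℝ) - 2) := by nlinarith
    positivity
  obtain ⟨t, ht⟩ : ∃ t : ℕ, t = K * (K + 1) := ⟨_, rfl⟩
  obtain ⟨τ', hτ'⟩ : ∃ τ' : ℝ, τ' = 101 / 100 * τ := ⟨_, rfl⟩
  obtain ⟨σ, hσ⟩ : ∃ σ : ℝ, σ = (2 * t + K) * τ' + 1 / 100 := ⟨_, rfl⟩
  have hτ'pos : 0 < τ' := by rw [hτ']; positivity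
  have hσpos : 0 < σ := by rw [hσ]; positivity
  have hexp2 : σ + τ' + 3 * τ < 1 := by
    rw [hσ, ht]
    rw [← hτ'] at hexp
    push_cast at hexp ⊢
    have : (2 * (((K : ℝ) + 1) * (K + 1 - 1)) + (K + 1 - 1)) * τ' =
      (2 * (K * (K + 1)) + K) * τ' := by ring
    linarith
  obtain ⟨C, hC, hJB⟩ := vmvt hK (Δ := 1 / 100) (by norm_num)
  obtain ⟨c, hc, M, hM, hRA⟩ := rational_approx K (by omega)
  obtain ⟨c1, hc1⟩ : ∃ c1 : ℝ, c1 = ((1 / 800) ^ (2 * t) * (1 / (51200 * (K : ℝ))) ^ K) := ⟨_, rfl⟩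
  have hc1pos : 0 < c1 := by
    rw [hc1]
    have : (0 : ℝ) < K := by exact_mod_cast (by omega : 0 < K)
    positivity
  obtain ⟨C', hC'⟩ : ∃ C' : ℝ, C' = C / c1 := ⟨_, rfl⟩
  have hC'pos : 0 < C' := by rw [hC']; positivity
  obtain ⟨A1, hA1⟩ : ∃ A1 : ℝ, A1 = c * (C' + 1) * 200 * 3 := ⟨_, rfl⟩
  have hA1pos : 0 ≤ A1 := by rw [hA1]; positivity
  obtain ⟨N1, hN1⟩ := eventually_rpow (3200 * (C' + 1)) σ (1 - τ') (by linarith)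
  obtain ⟨N2, hN2⟩ := eventually_rpow A1 (σ + τ' + τ) 1 (by linarith)
  obtain ⟨N3, hN3⟩ := eventually_rpow (6 * K * M * A1) (σ + τ' + 2 * τ - 1) (-τ) (by linarith)
  refine ⟨N1 + N2 + N3 + 1, ?_⟩
  intro α hα0 N hN
  have E1 := hN1 N (by omega)
  have E2 := hN2 N (by omega)
  have E3 := hN3 N (by omega)
  have hN1' : 1 ≤ N := by omega
  have hNR : (1 : ℝ) ≤ N := by exact_mod_cast hN1'
  have hN0 : (0 : ℝ) < N := by linarith
  clear hN1 hN2 hN3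
  by_contra hcon
  push Not at hcon
  have hbig : ∀ n ∈ range N, (N : ℝ) ^ (-τ) ≤
      |(∑ i ∈ range (K + 2), α i * ((n : ℝ) + 1) ^ i) -
        round (∑ i ∈ range (K + 2), α i * ((n : ℝ) + 1) ^ i)| := by
    intro n hn
    rw [Finset.mem_range] at hn
    have := hcon (n + 1) (by omega) (by omega)
    push_cast at this
    exact this
  have x1 : 1 ≤ (N : ℝ) ^ τ' := Real.one_le_rpow hNR hτ'pos.le
  have x2 : 1 ≤ (N : ℝ) ^ τ := Real.one_le_rpow hNR hτpos.le
  have x3 : 1 ≤ (N : ℝ) ^ σ := Real.one_le_rpow hNR hσpos.le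
  obtain ⟨H, hH⟩ : ∃ H : ℕ, H = ⌈(N : ℝ) ^ τ'⌉₊ := ⟨_, rfl⟩
  have hH1 : (N : ℝ) ^ τ' ≤ H := by rw [hH]; exact Nat.le_ceil _
  have hH2 : (H : ℝ) ≤ 2 * (N : ℝ) ^ τ' := by
    have : (H : ℝ) < (N : ℝ) ^ τ' + 1 := by rw [hH]; exact Nat.ceil_lt_add_one (by linarith)
    linarith
  have hHR : (1 : ℝ) ≤ H := by linarith
  have hHone : 1 ≤ H := by exact_mod_cast hHR
  have hcond : 2 * ((100 : ℕ) : ℝ) * H * (1 / (2 * (N : ℝ) ^ (-τ))) ^ (2 * 100) ≤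
      (H : ℝ) ^ (2 * 100) := by
    have h1 : 1 / (2 * (N : ℝ) ^ (-τ)) = (1 / 2) * (N : ℝ) ^ τ := by
      rw [Real.rpow_neg hN0.le]
      field_simp
    rw [h1, mul_pow]
    have h2 : ((N : ℝ) ^ τ) ^ (2 * 100) ≤ (H : ℝ) ^ 199 := by
      calc ((N : ℝ) ^ τ) ^ (2 * 100) ≤ ((N : ℝ) ^ τ') ^ 199 := by
            rw [← Real.rpow_mul_natCast hN0.le, ← Real.rpow_mul_natCast hN0.le]
            apply Real.rpow_le_rpow_of_exponent_le hNR
            rw [hτ']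
            push_cast
            linarith
        _ ≤ (H : ℝ) ^ 199 := by gcongr
    have h3 : (200 : ℝ) * (1 / 2) ^ (2 * 100) ≤ 1 := by norm_num
    have h4 : (0 : ℝ) ≤ ((N : ℝ) ^ τ) ^ (2 * 100) := by positivity
    calc 2 * ((100 : ℕ) : ℝ) * H * ((1 / 2) ^ (2 * 100) * ((N : ℝ) ^ τ) ^ (2 * 100)) =
        (200 * (1 / 2) ^ (2 * 100)) * (H * ((N : ℝ) ^ τ) ^ (2 * 100)) := by
          push_cast
          ring
      _ ≤ 1 * (H * (H : ℝ) ^ 199) := by gcongr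
      _ = (H : ℝ) ^ (2 * 100) := by ring
  obtain ⟨h, hh1, hhH, hhP⟩ := large_sum (range N)
    (fun n : ℕ => ∑ i ∈ range (K + 2), α i * ((n : ℝ) + 1) ^ i) ((N : ℝ) ^ (-τ))
    (Real.rpow_pos_of_pos hN0 _) hbig H 100 hHone (by norm_num) hcond
  rw [Finset.card_range] at hhP
  obtain ⟨P, hP⟩ : ∃ P : ℝ, P = (N : ℝ) / (2 * ((100 : ℕ) : ℝ) * H) := ⟨_, rfl⟩
  rw [← hP] at hhP
  have hPpos : 0 < P := by rw [hP]; positivity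
  have hPN : P ≤ N := by
    rw [hP]
    apply div_le_self hN0.le
    push_cast
    linarith
  have hPlow : (N : ℝ) ^ (1 - τ') / 400 ≤ P := by
    rw [hP, Real.rpow_sub hN0, Real.rpow_one]
    rw [div_div, div_le_div_iff₀ (by positivity) (by positivity)]
    push_cast
    nlinarith
  obtain ⟨Y, hYd⟩ : ∃ Y : ℕ, Y = ⌊C' * (N : ℝ) ^ σ⌋₊ + 1 := ⟨_, rfl⟩
  have hY1 : C' * (N : ℝ) ^ σ < Y := by
    rw [hYd]
    push_cast
    exact Nat.lt_floor_add_one _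
  have hY2 : (Y : ℝ) ≤ (C' + 1) * (N : ℝ) ^ σ := by
    rw [hYd]
    push_cast
    have := Nat.floor_le (show 0 ≤ C' * (N : ℝ) ^ σ by positivity)
    linarith
  have hY8 : 8 * (Y : ℝ) ≤ P := by linarith
  have hJ := rhs_lower K t N (by omega) ht hN1' P τ' σ (1 / 100) C' hσ hC'pos Y hY1 hPlow
  rw [← hc1, hC', div_mul_cancel₀ _ hc1pos.ne'] at hJ
  have hJ2 := lt_of_le_of_lt (hJB N hN1') hJ
  have hsum : P ≤ ‖∑ n ∈ range N, ee (∑ i ∈ range (K + 2), (h * α i) * ((n : ℝ) + 1) ^ i)‖ := by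
    refine hhP.trans_eq ?_
    congr 1
    apply Finset.sum_congr rfl
    intro n _
    congr 1
    rw [Finset.mul_sum]
    apply Finset.sum_congr rfl
    intro i _
    ring
  obtain ⟨d, hd1, hdY, hd⟩ := hRA (K * (K + 1)) N Y P (fun i => h * α i) hN1' hPpos hPN hY8 hsum
    (by rw [ht] at hJ2; exact hJ2)
  obtain ⟨T, hT⟩ : ∃ T : ℕ, T = ⌈2 * (N : ℝ) ^ τ⌉₊ := ⟨_, rfl⟩
  have hT1 : 2 * (N : ℝ) ^ τ ≤ T := by rw [hT]; exact Nat.le_ceil _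
  have hT2 : (T : ℝ) ≤ 3 * (N : ℝ) ^ τ := by
    have : (T : ℝ) < 2 * (N : ℝ) ^ τ + 1 := by rw [hT]; exact Nat.ceil_lt_add_one (by linarith)
    linarith
  have hTone : 1 ≤ T := by
    have : (1 : ℝ) ≤ T := by linarith
    exact_mod_cast this
  have hhR : (h : ℝ) ≤ 200 * (N : ℝ) ^ τ' := by
    have : (h : ℝ) ≤ 100 * H := by exact_mod_cast hhH
    linarith
  have hdR : (d : ℝ) ≤ (C' + 1) * (N : ℝ) ^ σ := by
    have : (d : ℝ) ≤ Y := by exact_mod_cast hdY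
    linarith
  have hprodle : ((c * d * h * T : ℕ) : ℝ) ≤ A1 * (N : ℝ) ^ (σ + τ' + τ) := by
    push_cast
    calc (c : ℝ) * d * h * T ≤ c * ((C' + 1) * (N : ℝ) ^ σ) * (200 * (N : ℝ) ^ τ') *
        (3 * (N : ℝ) ^ τ) := by gcongr
      _ = A1 * (N : ℝ) ^ (σ + τ' + τ) := by
        rw [Real.rpow_add hN0, Real.rpow_add hN0, hA1]
        ring
  have hle : c * d * h * T ≤ N := by
    rw [Real.rpow_one] at E2
    exact_mod_cast hprodle.trans E2
  have hcd : 1 ≤ c * d := Nat.mul_pos hc hd1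
  have hfs := final_step K α hα0 N (c * d) h T hN1' hcd hh1 hTone M
    ((N : ℝ) ^ (-τ)) hM ?_ hle ?_
  · obtain ⟨n, hn1, hn2, hn3⟩ := hfs
    exact absurd hn3 (not_lt.2 (hcon n hn1 hn2))
  · intro i hi2 hiK
    obtain ⟨z, hz⟩ := hd i hi2 hiK
    refine ⟨z, ?_⟩
    have e : ((c * d * h : ℕ) : ℝ) * α i = ((c * d : ℕ) : ℝ) * (h * α i) := by push_cast; ring
    rw [e]
    refine hz.trans ?_
    have e2 : (N : ℝ) ^ i = (N : ℝ) ^ (i - 1) * N := by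
      rw [← pow_succ]
      congr 1
      omega
    rw [e2, div_le_div_iff₀ (by positivity) (by positivity)]
    have : M * P ≤ M * N := by gcongr
    calc M * P * (N : ℝ) ^ (i - 1) ≤ M * N * (N : ℝ) ^ (i - 1) := by gcongr
      _ = M * ((N : ℝ) ^ (i - 1) * N) := by ring
  · have f1 : 1 / ((T : ℝ) + 1) < (N : ℝ) ^ (-τ) / 2 := by
      rw [Real.rpow_neg hN0.le, ← one_div, div_div, div_lt_div_iff₀ (by positivity) (by positivity)]
      linarith
    have f2 : K * (T * M * (((c * d * h * T : ℕ) : ℝ) / N)) ≤ (N : ℝ) ^ (-τ) / 2 := by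
      calc K * (T * M * (((c * d * h * T : ℕ) : ℝ) / N)) ≤
          K * (3 * (N : ℝ) ^ τ * M * (A1 * (N : ℝ) ^ (σ + τ' + τ) / N)) := by gcongr
        _ = (6 * K * M * A1 * (N : ℝ) ^ (σ + τ' + 2 * τ - 1)) / 2 := by
          have : (N : ℝ) ^ (σ + τ' + 2 * τ - 1) = (N : ℝ) ^ (σ + τ' + τ) * (N : ℝ) ^ τ / N := by
            rw [← Real.rpow_add hN0, ← Real.rpow_sub_one hN0.ne']
            congr 1
            ring
          rw [this]
          ring
        _ ≤ (N : ℝ) ^ (-τ) / 2 := by gcongr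
    linarith

end Seven

end VMV

theorem statement17 (k : ℕ) (hk : 4 ≤ k) :
    ∀ ε : ℝ, 0 < ε → ∃ N₀ : ℕ, ∀ α : Fin k → ℝ, ∀ N : ℕ, N₀ ≤ N →
      ∃ n : ℕ, 1 ≤ n ∧ n ≤ N ∧
        |(∑ j : Fin k, α j * (n : ℝ) ^ ((j : ℕ) + 1)) -
          round (∑ j : Fin k, α j * (n : ℝ) ^ ((j : ℕ) + 1))| <
        (N : ℝ) ^ (ε - 1 / (4 * (k : ℝ) * ((k : ℝ) - 2))) := by
  intro ε hε
  obtain ⟨N₀, H⟩ := VMV.main_thm k hk _ rfl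
  refine ⟨N₀ + 1, fun α N hN => ?_⟩
  set a : ℕ → ℝ := fun i => if h : 1 ≤ i ∧ i - 1 < k then α ⟨i - 1, h.2⟩ else 0 with ha
  obtain ⟨n, hn1, hn2, hn3⟩ := H a (by simp [ha]) N (by omega)
  have e : ∑ i ∈ Finset.range (k + 1), a i * (n : ℝ) ^ i =
      ∑ j : Fin k, α j * (n : ℝ) ^ ((j : ℕ) + 1) := by
    rw [Finset.sum_range_succ', Finset.sum_range]
    simp [ha]
  rw [e] at hn3
  refine ⟨n, hn1, hn2, lt_of_lt_of_le hn3 ?_⟩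
  apply Real.rpow_le_rpow_of_exponent_le
  · exact_mod_cast (by omega : 1 ≤ N)
  · linarith
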